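/- arXiv:1808.01985 — 2 statements merged into one kernel-verified Lean document; each statement's English description precedes it below -/
import Mathlib

section
/- Quantitative weighted bound for multilinear sparse forms: Let r_1,…,r_{m+1} ∈ (0,∞) and p_1,…,p_{m+1} ∈ (0,∞] with 1/p_j < 1/r_j for all j and Σ_{j=1}^{m+1} 1/p_j = 1, and let w_1,…,w_{m+1} be weights with ∏_{j=1}^{m+1} w_j = 1 and [(w_1,…,w_{m+1})]_{(p_1,…,p_{m+1}),((r_1,…,r_{m+1}),∞)} < ∞. Then for every sparse collection S and all f_j, Λ_{(r_1,…,r_{m+1}),S}(f_1,…,f_{m+1}) ≲ c_{p⃗,r⃗} · [(w_1,…,w_{m+1})]_{(p_1,…,p_{m+1}),((r_1,…,r_{m+1}),∞)}^{ max_{j=1,…,m+1} (1/r_j)/(1/r_j−1/p_j) } · ∏_{j=1}^{m+1} ‖f_j‖_{L^{p_j}(w_j^{p_j})}, where c_{p⃗,r⃗} = ∏_{j=1}^{m+1} [ (1/r_j)/(1/r_j−1/p_j) ]^{1/r_j} and the implicit constant depends only on the dimension n. -/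
open MeasureTheory ENNReal

noncomputable section

namespace Paper

/-- An axis-parallel (half-open) cube in `ℝⁿ` with positive side length. -/
def IsCube {n : ℕ} (Q : Set (Fin n → ℝ)) : Prop :=
  ∃ (c : Fin n → ℝ) (h : ℝ), 0 < h ∧
    Q = Set.univ.pi fun i => Set.Ico (c i) (c i + h)

/-- A weight on `ℝⁿ`: a measurable, everywhere positive function. -/
def IsWeight {n : ℕ} (w : (Fin n → ℝ) → ℝ) : Prop :=
  Measurable w ∧ ∀ x, 0 < w x

/-- `expOf ρ` is the exponent `1/ρ ∈ (0,∞]`; `ρ = 0` encodes the exponent `∞`. -/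
def expOf (ρ : ℝ) : ℝ≥0∞ := if ρ = 0 then ∞ else ENNReal.ofReal (1 / ρ)

/-- The average `⟨f⟩_{1/τ, Q}` of a real-valued `f` over `Q`;
`τ = 0` encodes the essential supremum `⟨f⟩_{∞,Q}`. -/
def avg {n : ℕ} (τ : ℝ) (f : (Fin n → ℝ) → ℝ) (Q : Set (Fin n → ℝ)) : ℝ≥0∞ :=
  if τ = 0 then essSup (fun x => ENNReal.ofReal |f x|) (volume.restrict Q)
  else ((volume Q)⁻¹ * ∫⁻ x in Q, ENNReal.ofReal |f x| ^ (1 / τ)) ^ τ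

/-- The average `⟨g⟩_{1/τ, Q}` of an `ℝ≥0∞`-valued `g` over `Q`. -/
def avgE {n : ℕ} (τ : ℝ) (g : (Fin n → ℝ) → ℝ≥0∞) (Q : Set (Fin n → ℝ)) : ℝ≥0∞ :=
  if τ = 0 then essSup g (volume.restrict Q)
  else ((volume Q)⁻¹ * ∫⁻ x in Q, g x ^ (1 / τ)) ^ τ

/-- The weighted norm `‖f‖_{L^{1/ρ}(w^{1/ρ})} = ‖f·w‖_{L^{1/ρ}(ℝⁿ)}`;
`ρ = 0` encodes `p = ∞`. -/
def wnorm {n : ℕ} (ρ : ℝ) (f w : (Fin n → ℝ) → ℝ) : ℝ≥0∞ :=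
  eLpNorm (fun x => f x * w x) (expOf ρ) volume

/-- The weighted norm `‖g·w‖_{L^{1/ρ}}` of an `ℝ≥0∞`-valued function `g`. -/
def wnormE {n : ℕ} (ρ : ℝ) (g : (Fin n → ℝ) → ℝ≥0∞) (w : (Fin n → ℝ) → ℝ) : ℝ≥0∞ :=
  if ρ = 0 then essSup (fun x => g x * ENNReal.ofReal (w x)) volume
  else (∫⁻ x, (g x * ENNReal.ofReal (w x)) ^ (1 / ρ)) ^ ρ

/-- The weak weighted norm `‖f‖_{L^{1/ρ,∞}(w^{1/ρ})}
  = sup_{t>0} t · (∫_{|f|>t} w^{1/ρ})^{ρ}`; `ρ = 0` encodes `p = ∞`. -/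
def wWeakNorm {n : ℕ} (ρ : ℝ) (f w : (Fin n → ℝ) → ℝ) : ℝ≥0∞ :=
  if ρ = 0 then wnorm 0 f w
  else ⨆ t : Set.Ioi (0 : ℝ),
    ENNReal.ofReal t.1 *
      (∫⁻ x in {x | t.1 < |f x|}, ENNReal.ofReal (w x) ^ (1 / ρ)) ^ ρ

/-- The weak weighted norm of an `ℝ≥0∞`-valued function. -/
def wWeakNormE {n : ℕ} (ρ : ℝ) (g : (Fin n → ℝ) → ℝ≥0∞) (w : (Fin n → ℝ) → ℝ) : ℝ≥0∞ :=
  if ρ = 0 then essSup (fun x => g x * ENNReal.ofReal (w x)) volume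
  else ⨆ t : Set.Ioi (0 : ℝ),
    ENNReal.ofReal t.1 *
      (∫⁻ x in {x | ENNReal.ofReal t.1 < g x}, ENNReal.ofReal (w x) ^ (1 / ρ)) ^ ρ

/-- The weak `L¹(ℝⁿ)` quasinorm (with respect to Lebesgue measure) of an
`ℝ≥0∞`-valued function. -/
def weakL1 {n : ℕ} (g : (Fin n → ℝ) → ℝ≥0∞) : ℝ≥0∞ :=
  ⨆ t : Set.Ioi (0 : ℝ), ENNReal.ofReal t.1 * volume {x | ENNReal.ofReal t.1 < g x}

/-- The limited range multilinear weight constant `[w⃗]_{p⃗,(r⃗,s)}`, written in terms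
of the reciprocal exponents `rinv j = 1/r_j`, `pinv j = 1/p_j` and `sinv = 1/s`. -/
def wConst {n m : ℕ} (rinv pinv : Fin m → ℝ) (sinv : ℝ)
    (w : Fin m → (Fin n → ℝ) → ℝ) : ℝ≥0∞ :=
  ⨆ Q : {Q : Set (Fin n → ℝ) // IsCube Q},
    (∏ j, avg (rinv j - pinv j) (fun x => (w j x)⁻¹) Q.1) *
      avg ((∑ j, pinv j) - sinv) (fun x => ∏ j, w j x) Q.1

/-- The symmetric weight constant `[w⃗]_{p⃗,(r⃗,∞)} = sup_Q ∏_j ⟨w_j⁻¹⟩_{1/(1/r_j - 1/p_j),Q}`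
for tuples of weights with `∏_j w_j = 1`. -/
def wConstS {n m : ℕ} (rinv pinv : Fin m → ℝ)
    (w : Fin m → (Fin n → ℝ) → ℝ) : ℝ≥0∞ :=
  ⨆ Q : {Q : Set (Fin n → ℝ) // IsCube Q},
    ∏ j, avg (rinv j - pinv j) (fun x => (w j x)⁻¹) Q.1

/-- The multisublinear Hardy-Littlewood maximal operator
`M_{(r_1,…,r_m)}(f⃗)(x) = sup_{Q ∋ x} ∏_j ⟨f_j⟩_{r_j,Q}` (reciprocal exponents). -/
def maximal {n m : ℕ} (rinv : Fin m → ℝ)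
    (f : Fin m → (Fin n → ℝ) → ℝ) (x : Fin n → ℝ) : ℝ≥0∞ :=
  ⨆ Q : {Q : Set (Fin n → ℝ) // IsCube Q ∧ x ∈ Q}, ∏ j, avg (rinv j) (f j) Q.1

/-- A sparse family of cubes (with sparsity constant 2): to each cube `Q` of the family
is associated a major subset `E Q ⊆ Q` with `|Q| ≤ 2|E Q|`, and these sets are
pairwise disjoint. -/
structure SparseFamily (n : ℕ) where
  cubes : Set (Set (Fin n → ℝ))
  E : Set (Fin n → ℝ) → Set (Fin n → ℝ)
  isCube : ∀ Q ∈ cubes, IsCube Q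
  E_subset : ∀ Q ∈ cubes, E Q ⊆ Q
  E_meas : ∀ Q ∈ cubes, MeasurableSet (E Q)
  E_disj : ∀ Q ∈ cubes, ∀ Q' ∈ cubes, Q ≠ Q' → Disjoint (E Q) (E Q')
  density : ∀ Q ∈ cubes, volume Q ≤ 2 * volume (E Q)

/-- The sparse form `Λ_{r⃗,S}(f⃗) = ∑_{Q∈S} (∏_j ⟨f_j⟩_{r_j,Q}) |Q|`. -/
def sparseForm {n m : ℕ} (rinv : Fin m → ℝ) (S : SparseFamily n)
    (f : Fin m → (Fin n → ℝ) → ℝ) : ℝ≥0∞ :=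
  ∑' Q : S.cubes, (∏ j, avg (rinv j) (f j) Q.1) * volume Q.1

/-- The sparse operator `A_{r⃗,S}(f⃗) = ∑_{Q∈S} (∏_j ⟨f_j⟩_{r_j,Q}) χ_Q`. -/
def sparseOp {n m : ℕ} (rinv : Fin m → ℝ) (S : SparseFamily n)
    (f : Fin m → (Fin n → ℝ) → ℝ) (x : Fin n → ℝ) : ℝ≥0∞ :=
  ∑' Q : S.cubes, (∏ j, avg (rinv j) (f j) Q.1) *
    (Q.1).indicator (fun _ => (1 : ℝ≥0∞)) x

end Paper
namespace Paper

/-- The half-open cube with lower corner `c` and side length `h`. -/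
def box {n : ℕ} (c : Fin n → ℝ) (h : ℝ) : Set (Fin n → ℝ) :=
  Set.univ.pi fun i => Set.Ico (c i) (c i + h)

lemma mem_box {n : ℕ} {c : Fin n → ℝ} {h : ℝ} {x : Fin n → ℝ} :
    x ∈ box c h ↔ ∀ i, c i ≤ x i ∧ x i < c i + h := by
  simp [box]

lemma measurableSet_box {n : ℕ} (c : Fin n → ℝ) (h : ℝ) : MeasurableSet (box c h) :=
  MeasurableSet.univ_pi fun _ => measurableSet_Ico

lemma volume_box {n : ℕ} (c : Fin n → ℝ) (h : ℝ) :
    volume (box c h) = ENNReal.ofReal h ^ n := by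
  simp [box, Real.volume_pi_Ico]

/-- A sparse family of cubes, indexed by `ι`. -/
structure SparseBoxes (n : ℕ) (ι : Type*) where
  corner : ι → Fin n → ℝ
  side : ι → ℝ
  E : ι → Set (Fin n → ℝ)
  side_pos : ∀ i, 0 < side i
  E_subset : ∀ i, E i ⊆ box (corner i) (side i)
  E_meas : ∀ i, MeasurableSet (E i)
  E_disj : Pairwise (Function.onFun Disjoint E)
  density : ∀ i, volume (box (corner i) (side i)) ≤ 2 * volume (E i)

/-- The cube with index `i`. -/
def SparseBoxes.Q {n : ℕ} {ι : Type*} (B : SparseBoxes n ι) (i : ι) : Set (Fin n → ℝ) :=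
  box (B.corner i) (B.side i)

lemma SparseBoxes.measurableSet_Q {n : ℕ} {ι : Type*} (B : SparseBoxes n ι) (i : ι) :
    MeasurableSet (B.Q i) := measurableSet_box _ _

lemma SparseBoxes.volume_Q {n : ℕ} {ι : Type*} (B : SparseBoxes n ι) (i : ι) :
    volume (B.Q i) = ENNReal.ofReal (B.side i) ^ n := volume_box _ _

lemma SparseBoxes.volume_Q_ne_zero {n : ℕ} {ι : Type*} (B : SparseBoxes n ι) (i : ι) :
    volume (B.Q i) ≠ 0 := by
  rw [B.volume_Q]
  exact pow_ne_zero _ (by simpa using B.side_pos i)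

lemma SparseBoxes.volume_Q_ne_top {n : ℕ} {ι : Type*} (B : SparseBoxes n ι) (i : ι) :
    volume (B.Q i) ≠ ∞ := by
  rw [B.volume_Q]
  exact pow_ne_top ofReal_ne_top

/-- The sequence `a` satisfies a weak-type Carleson condition with respect to the sets `Q i`. -/
def HasWeakType {α ι : Type*} [MeasurableSpace α] (a : ι → ℝ≥0∞) (Q : ι → Set α)
    (ν : Measure α) (K : ℝ≥0∞) : Prop :=
  ∀ (F : Finset ι) (μ : Measure α), (∀ i ∈ F, ν (Q i) ≤ μ (Q i)) → ∑ i ∈ F, a i ≤ K * μ Set.univ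

lemma SparseBoxes.sum_volume_le {n : ℕ} {ι : Type*} (B : SparseBoxes n ι) (F : Finset ι)
    {A : Set (Fin n → ℝ)} (hA : ∀ i ∈ F, B.Q i ⊆ A) :
    ∑ i ∈ F, volume (B.Q i) ≤ 2 * volume A := by
  calc ∑ i ∈ F, volume (B.Q i) ≤ ∑ i ∈ F, 2 * volume (B.E i) :=
        Finset.sum_le_sum fun i _ => B.density i
    _ = 2 * volume (⋃ i ∈ F, B.E i) := by
        rw [← Finset.mul_sum, measure_biUnion_finset (fun i _ j _ hij => B.E_disj hij)
          fun i _ => B.E_meas i]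
    _ ≤ 2 * volume A := by
        gcongr
        exact Set.iUnion₂_subset fun i hi => (B.E_subset i).trans (hA i hi)

lemma SparseBoxes.hasWeakType_volume {n : ℕ} {ι : Type*} (B : SparseBoxes n ι) :
    HasWeakType (fun i => volume (B.Q i)) B.Q volume (2 * 5 ^ n) := by
  classical
  intro F μ hF
  obtain ⟨u, huF, hu, hcov⟩ := Vitali.exists_disjoint_subfamily_covering_enlargement
    B.Q (F : Set ι) B.side 2 one_lt_two (fun i _ => (B.side_pos i).le) (∑ i ∈ F, B.side i)
    (fun i hi => Finset.single_le_sum (fun j _ => (B.side_pos j).le) hi)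
    (fun i _ => ⟨B.corner i, mem_box.2 fun k => ⟨le_rfl, by linarith [B.side_pos i]⟩⟩)
  have hfin : u.Finite := F.finite_toSet.subset huF
  set U := hfin.toFinset with hU
  have hUF : U ⊆ F := by intro i hi; simpa using huF (by simpa [hU] using hi)
  let R : ι → Set (Fin n → ℝ) := fun i => box (fun k => B.corner i k - 2 * B.side i) (5 * B.side i)
  have hsub : ∀ i ∈ F, B.Q i ⊆ ⋃ j ∈ U, R j := by
    intro i hi x hx
    obtain ⟨j, hj, ⟨z, hzi, hzj⟩, hs⟩ := hcov i hi
    refine Set.mem_iUnion₂.2 ⟨j, by simpa [hU] using hj, mem_box.2 fun k => ?_⟩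
    have h1 := mem_box.1 hx k
    have h2 := mem_box.1 hzi k
    have h3 := mem_box.1 hzj k
    constructor <;> linarith
  calc ∑ i ∈ F, volume (B.Q i) ≤ 2 * volume (⋃ j ∈ U, R j) := B.sum_volume_le F hsub
    _ ≤ 2 * ∑ j ∈ U, volume (R j) := by gcongr; exact measure_biUnion_finset_le _ _
    _ = 2 * 5 ^ n * ∑ j ∈ U, volume (B.Q j) := by
        rw [mul_assoc, Finset.mul_sum (a := (5 : ℝ≥0∞) ^ n)]
        congr 1
        refine Finset.sum_congr rfl fun j _ => ?_
        rw [B.volume_Q, volume_box, ENNReal.ofReal_mul (by norm_num), mul_pow]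
        norm_num
    _ ≤ 2 * 5 ^ n * ∑ j ∈ U, μ (B.Q j) := by
        gcongr 2 * 5 ^ n * ?_
        exact Finset.sum_le_sum fun j hj => hF j (hUF hj)
    _ = 2 * 5 ^ n * μ (⋃ j ∈ U, B.Q j) := by
        rw [measure_biUnion_finset _ fun i _ => B.measurableSet_Q i]
        intro i hi j hj hij
        exact hu (by simpa [hU] using hi) (by simpa [hU] using hj) hij
    _ ≤ 2 * 5 ^ n * μ Set.univ := by gcongr; exact Set.subset_univ _

/-- Greedy selection of an essentially disjoint subfamily ordered by `e`. -/
lemma exists_selection {α ι : Type*} [MeasurableSpace α] (μ : Measure α) (A : ι → Set α)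
    (hA : ∀ i, MeasurableSet (A i)) (e : ι → ℝ) (F : Finset ι) :
    ∃ S ⊆ F, ∃ D : ι → Set α, (∀ s, MeasurableSet (D s)) ∧ (∀ s, D s ⊆ A s) ∧
      (S : Set ι).PairwiseDisjoint D ∧ (∀ s ∈ S, μ (A s) ≤ 2 * μ (D s)) ∧
      ∀ i ∈ F, μ (A i) ≤ 2 * ∑ s ∈ S with e i ≤ e s, μ (A i ∩ D s) := by
  classical
  suffices H : ∃ S ⊆ F, ∃ D : ι → Set α, (∀ s, MeasurableSet (D s)) ∧ (∀ s, D s ⊆ A s) ∧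
      (S : Set ι).PairwiseDisjoint D ∧ (∀ s ∈ S, μ (A s) ≤ 2 * μ (D s)) ∧
      (⋃ s ∈ S, A s) = (⋃ s ∈ S, D s) ∧
      ∀ i ∈ F, μ (A i) ≤ 2 * ∑ s ∈ S with e i ≤ e s, μ (A i ∩ D s) by
    obtain ⟨S, h1, D, h2, h3, h4, h5, -, h6⟩ := H
    exact ⟨S, h1, D, h2, h3, h4, h5, h6⟩
  induction F using Finset.induction_on_min_value e with
  | empty => exact ⟨∅, le_rfl, fun _ => ∅, by simp⟩
  | insert a F haF hmin ih =>
    obtain ⟨S, hSF, D, hDm, hDA, hdisj, hD2, hun, hcov⟩ := ih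
    have haS : a ∉ S := fun h => haF (hSF h)
    have hUm : MeasurableSet (⋃ s ∈ S, A s) := S.measurableSet_biUnion fun s _ => hA s
    by_cases hsel : μ (A a) ≤ 2 * μ (A a \ ⋃ s ∈ S, A s)
    · set D' := Function.update D a (A a \ ⋃ s ∈ S, A s) with hD'
      have hne : ∀ s ∈ S, D' s = D s := fun s hs =>
        Function.update_of_ne (ne_of_mem_of_not_mem hs haS) _ _
      have ha' : D' a = A a \ ⋃ s ∈ S, A s := Function.update_self _ _ _
      refine ⟨insert a S, Finset.insert_subset_insert _ hSF, D', ?_, ?_, ?_, ?_, ?_, ?_⟩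
      · intro s
        by_cases h : s = a
        · subst h; rw [ha']; exact (hA s).diff hUm
        · rw [hD', Function.update_of_ne h]; exact hDm s
      · intro s
        by_cases h : s = a
        · subst h; rw [ha']; exact Set.sdiff_subset
        · rw [hD', Function.update_of_ne h]; exact hDA s
      · rw [Finset.coe_insert, Set.pairwiseDisjoint_insert_of_notMem (by simpa using haS)]
        refine ⟨fun s hs t ht hst => ?_, fun s hs => ?_⟩
        · simp only [Function.onFun]
          rw [hne s hs, hne t ht]
          exact hdisj hs ht hst
        · rw [ha', hne s hs]
          refine Set.disjoint_left.2 fun x hx hxs => hx.2 ?_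
          exact Set.mem_iUnion₂.2 ⟨s, hs, hDA s hxs⟩
      · intro s hs
        rcases Finset.mem_insert.1 hs with rfl | hs
        · rw [ha']; exact hsel
        · rw [hne s hs]; exact hD2 s hs
      · rw [Finset.set_biUnion_insert, Finset.set_biUnion_insert, ha',
          Set.iUnion₂_congr hne, ← hun, Set.sdiff_union_self]
      · intro i hi
        rcases Finset.mem_insert.1 hi with rfl | hi
        · calc μ (A i) ≤ 2 * μ (A i ∩ D' i) := by
                rwa [ha', Set.inter_eq_self_of_subset_right Set.sdiff_subset]
            _ ≤ _ := by
                gcongr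
                exact Finset.single_le_sum (f := fun s => μ (A i ∩ D' s)) (fun _ _ => zero_le)
                  (by simp)
        · refine (hcov i hi).trans ?_
          gcongr 2 * ?_
          calc ∑ s ∈ S with e i ≤ e s, μ (A i ∩ D s) = ∑ s ∈ S with e i ≤ e s, μ (A i ∩ D' s) :=
                Finset.sum_congr rfl fun s hs => by rw [hne s (Finset.mem_filter.1 hs).1]
            _ ≤ _ := Finset.sum_le_sum_of_subset
                (Finset.filter_subset_filter _ (Finset.subset_insert _ _))
    · refine ⟨S, hSF.trans (Finset.subset_insert _ _), D, hDm, hDA, hdisj, hD2, hun, ?_⟩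
      intro i hi
      rcases Finset.mem_insert.1 hi with rfl | hi
      · push Not at hsel
        have h1 : μ (A i ∩ ⋃ s ∈ S, A s) ≤ ∑ s ∈ S with e i ≤ e s, μ (A i ∩ D s) := by
          rw [Finset.filter_true_of_mem fun s hs => hmin s (hSF hs), hun, Set.inter_iUnion₂]
          exact measure_biUnion_finset_le _ _
        have h2 := measure_inter_add_sdiff (μ := μ) (A i) hUm
        by_cases htop : μ (A i ∩ ⋃ s ∈ S, A s) = ∞
        · rw [htop, top_le_iff] at h1
          rw [h1]; simp
        have h3 : μ (A i \ ⋃ s ∈ S, A s) ≤ μ (A i ∩ ⋃ s ∈ S, A s) := by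
          have hd : μ (A i \ ⋃ s ∈ S, A s) ≠ ∞ := by
            intro h; rw [h] at hsel; simp at hsel
          rw [← h2, two_mul] at hsel
          exact (lt_of_add_lt_add_right hsel).le
        calc μ (A i) ≤ 2 * μ (A i ∩ ⋃ s ∈ S, A s) := by rw [← h2, two_mul]; gcongr
          _ ≤ _ := by gcongr
      · exact hcov i hi

lemma SparseBoxes.card_le {n : ℕ} {ι : Type*} (B : SparseBoxes n ι) (F : Finset ι)
    (x : Fin n → ℝ) {t : ℝ} (ht : 0 < t)
    (hF : ∀ i ∈ F, x ∈ B.Q i ∧ t ≤ B.side i ∧ B.side i < 2 * t) :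
    (F.card : ℝ≥0∞) ≤ 2 * 4 ^ n := by
  have h1 : ∑ i ∈ F, volume (B.Q i) ≤ 2 * volume (box (fun k => x k - 2 * t) (4 * t)) := by
    refine B.sum_volume_le F fun i hi y hy => mem_box.2 fun k => ?_
    obtain ⟨hx, h1, h2⟩ := hF i hi
    have h3 := mem_box.1 hx k
    have h4 := mem_box.1 hy k
    constructor <;> linarith
  have h2 : (F.card : ℝ≥0∞) * ENNReal.ofReal t ^ n ≤ ∑ i ∈ F, volume (B.Q i) := by
    rw [← nsmul_eq_mul]
    refine Finset.card_nsmul_le_sum _ _ _ fun i hi => ?_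
    rw [B.volume_Q]
    gcongr
    exact (hF i hi).2.1
  rw [volume_box, ENNReal.ofReal_mul (by norm_num), mul_pow, ← mul_assoc] at h1
  have h0 : ENNReal.ofReal t ^ n ≠ 0 := pow_ne_zero _ (by simpa using ht)
  have h3 := (ENNReal.mul_le_mul_iff_left h0 (pow_ne_top ofReal_ne_top)).1 (h2.trans h1)
  simpa using h3

open Classical in
lemma SparseBoxes.sum_div_side_le {n : ℕ} {ι : Type*} (B : SparseBoxes n ι) (F : Finset ι)
    (x : Fin n → ℝ) {t : ℝ} (ht : 0 < t) (hF : ∀ i ∈ F, x ∈ B.Q i ∧ t ≤ B.side i) :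
    ∑ i ∈ F, ENNReal.ofReal (t / B.side i) ≤ 4 * 4 ^ n := by
  have key : ∀ i ∈ F, ENNReal.ofReal (t / B.side i) ≤
      ∑' k : ℕ, if 2 ^ k * t ≤ B.side i ∧ B.side i < 2 * (2 ^ k * t) then (2⁻¹ : ℝ≥0∞) ^ k else 0 := by
    intro i hi
    obtain ⟨k, hk1, hk2⟩ := exists_nat_pow_near (x := B.side i / t) (y := 2)
      ((one_le_div ht).2 (hF i hi).2) one_lt_two
    rw [le_div_iff₀ ht] at hk1
    rw [div_lt_iff₀ ht] at hk2
    refine le_trans ?_ (ENNReal.le_tsum k)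
    rw [if_pos ⟨hk1, by rw [pow_succ] at hk2; linarith⟩]
    have : (2⁻¹ : ℝ≥0∞) ^ k = ENNReal.ofReal ((2 ^ k)⁻¹) := by
      rw [ENNReal.ofReal_inv_of_pos (by positivity), ENNReal.ofReal_pow (by norm_num),
        ENNReal.inv_pow]
      norm_num
    rw [this]
    apply ENNReal.ofReal_le_ofReal
    rw [div_le_iff₀ (B.side_pos i), inv_mul_eq_div, le_div_iff₀ (by positivity)]
    linarith
  calc ∑ i ∈ F, ENNReal.ofReal (t / B.side i) ≤ ∑ i ∈ F, _ := Finset.sum_le_sum key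
    _ = ∑' k : ℕ, ∑ i ∈ F, if 2 ^ k * t ≤ B.side i ∧ B.side i < 2 * (2 ^ k * t)
          then (2⁻¹ : ℝ≥0∞) ^ k else 0 :=
        (Summable.tsum_finsetSum fun _ _ => ENNReal.summable).symm
    _ ≤ ∑' k : ℕ, 2 * 4 ^ n * (2⁻¹ : ℝ≥0∞) ^ k := by
        gcongr with k
        rw [← Finset.sum_filter, Finset.sum_const, nsmul_eq_mul]
        gcongr
        refine B.card_le _ x (t := 2 ^ k * t) (by positivity) fun i hi => ?_
        rw [Finset.mem_filter] at hi
        exact ⟨(hF i hi.1).1, hi.2⟩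
    _ = 4 * 4 ^ n := by
        rw [ENNReal.tsum_mul_left, ENNReal.tsum_geometric, ENNReal.one_sub_inv_two, inv_inv]
        ring

/-- The relative size below which a cube is negligible with respect to a cube with defect `L`. -/
def smallness (n : ℕ) (L : ℝ) : ℝ := 1 / (4 * (n + 1) * (1 + L))

lemma smallness_pos (n : ℕ) {L : ℝ} (hL : 0 ≤ L) : 0 < smallness n L := by
  unfold smallness; positivity

lemma smallness_le (n : ℕ) {L : ℝ} (hL : 0 ≤ L) : smallness n L ≤ 1 / 4 := by
  unfold smallness
  apply one_div_le_one_div_of_le (by norm_num)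
  have : (0 : ℝ) ≤ n := n.cast_nonneg
  nlinarith [mul_nonneg this hL]

lemma SparseBoxes.sum_exp_le {n : ℕ} {ι : Type*} (B : SparseBoxes n ι) {L : ι → ℝ}
    (hL : ∀ i, 0 ≤ L i) (F : Finset ι) (x : Fin n → ℝ) {t : ℝ} (ht : 0 < t)
    (hF : ∀ i ∈ F, x ∈ B.Q i ∧ smallness n (L i) * B.side i ≤ t ∧ t ≤ B.side i) :
    ∑ i ∈ F, ENNReal.ofReal (Real.exp (-L i)) ≤ 16 * (n + 1) * 4 ^ n := by
  have hi : ∀ i ∈ F, ENNReal.ofReal (Real.exp (-L i)) ≤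
      ENNReal.ofReal (4 * (n + 1)) * ENNReal.ofReal (t / B.side i) := by
    intro i hi
    rw [← ENNReal.ofReal_mul (by positivity)]
    apply ENNReal.ofReal_le_ofReal
    have h1 : Real.exp (-L i) ≤ 1 / (1 + L i) := by
      rw [Real.exp_neg, ← one_div]
      exact one_div_le_one_div_of_le (by linarith [hL i]) (by linarith [Real.add_one_le_exp (L i)])
    refine h1.trans ?_
    have h2 := (hF i hi).2.1
    have h3 := B.side_pos i
    have h4 := hL i
    rw [smallness, div_mul_eq_mul_div, div_le_iff₀ (by positivity)] at h2
    rw [mul_div_assoc', div_le_div_iff₀ (by positivity) h3]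
    linarith
  calc _ ≤ ∑ i ∈ F, ENNReal.ofReal (4 * (n + 1)) * ENNReal.ofReal (t / B.side i) :=
        Finset.sum_le_sum hi
    _ ≤ ENNReal.ofReal (4 * (n + 1)) * (4 * 4 ^ n) := by
        rw [← Finset.mul_sum]
        gcongr
        exact B.sum_div_side_le F x ht fun i hi => ⟨(hF i hi).1, (hF i hi).2.2⟩
    _ = _ := by
        rw [ENNReal.ofReal_mul (by norm_num), ENNReal.ofReal_add (by positivity) (by norm_num)]
        simp only [ENNReal.ofReal_natCast, ENNReal.ofReal_one, ENNReal.ofReal_ofNat]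
        ring

lemma lintegral_Ioo_rpow {s : ℝ} (hs : 0 < s) {b : ℝ} (hb : 0 ≤ b) :
    ∫⁻ l in Set.Ioo 0 b, ENNReal.ofReal (l ^ (s - 1)) = ENNReal.ofReal (b ^ s / s) := by
  have hfin_int : IntervalIntegrable (fun l : ℝ => l ^ (s - 1)) volume 0 b :=
    intervalIntegral.intervalIntegrable_rpow' (by linarith)
  have hfin_int' := (intervalIntegrable_iff_integrableOn_Ioo_of_le hb).1 hfin_int
  rw [← ofReal_integral_eq_lintegral_ofReal hfin_int', ← integral_Ioc_eq_integral_Ioo,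
    ← intervalIntegral.integral_of_le hb, integral_rpow (Or.inl (by linarith))]
  · simp [Real.zero_rpow hs.ne']
  · filter_upwards [ae_restrict_mem measurableSet_Ioo] with l hl
    exact Real.rpow_nonneg hl.1.le _

/-- The layer-cake formula for a single value. -/
lemma lintegral_layer {s : ℝ} (hs : 0 < s) (y : ℝ≥0∞) :
    ∫⁻ l in Set.Ioi (0 : ℝ), (if ENNReal.ofReal l < y then ENNReal.ofReal (l ^ (s - 1)) else 0) =
      y ^ s / ENNReal.ofReal s := by
  rcases eq_or_ne y ∞ with rfl | hy
  · simp only [ofReal_lt_top, if_true, ENNReal.top_rpow_of_pos hs,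
      ENNReal.top_div_of_ne_top ofReal_ne_top]
    refine ENNReal.eq_top_of_forall_nnreal_le fun r => ?_
    have h := lintegral_Ioo_rpow hs (b := ((s * r : ℝ)) ^ (1 / s)) (by positivity)
    rw [← Real.rpow_mul (by positivity), one_div_mul_cancel hs.ne', Real.rpow_one,
      mul_div_cancel_left₀ _ hs.ne', ENNReal.ofReal_coe_nnreal] at h
    rw [← h]
    exact lintegral_mono_set fun l hl => hl.1
  · have h := lintegral_Ioo_rpow hs (b := y.toReal) ENNReal.toReal_nonneg
    rw [ENNReal.ofReal_div_of_pos hs, ← ENNReal.ofReal_rpow_of_nonneg ENNReal.toReal_nonneg hs.le,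
      ENNReal.ofReal_toReal hy] at h
    rw [← h, ← lintegral_indicator measurableSet_Ioi, ← lintegral_indicator measurableSet_Ioo]
    congr 1 with l
    by_cases hl : 0 < l
    · by_cases hly : l < y.toReal
      · have : ENNReal.ofReal l < y := (ENNReal.ofReal_lt_iff_lt_toReal hl.le hy).2 hly
        simp [hl, hly, this]
      · have : ¬ ENNReal.ofReal l < y := by rwa [ENNReal.ofReal_lt_iff_lt_toReal hl.le hy]
        simp [hl, hly, this]
    · simp [hl]

lemma HasWeakType.sum_layer_le {α ι : Type*} [MeasurableSpace α] {a : ι → ℝ≥0∞} {Q : ι → Set α}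
    {ν : Measure α} {K : ℝ≥0∞} (h : HasWeakType a Q ν K) (hQ : ∀ i, MeasurableSet (Q i))
    (h0 : ∀ i, ν (Q i) ≠ 0) (ht : ∀ i, ν (Q i) ≠ ∞) {g : α → ℝ≥0∞} (hg : Measurable g)
    (F : Finset ι) {l : ℝ} (hl : 0 < l)
    (hF : ∀ i ∈ F, ENNReal.ofReal l < (ν (Q i))⁻¹ * ∫⁻ x in Q i, g x ∂ν) :
    ∑ i ∈ F, a i ≤
      K * (ENNReal.ofReal (2 / l) * ∫⁻ x, (if ENNReal.ofReal l < 2 * g x then g x else 0) ∂ν) := by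
  set φ : α → ℝ≥0∞ := fun x => if ENNReal.ofReal l < 2 * g x then g x else 0 with hφ
  have hφm : Measurable φ :=
    Measurable.ite (measurableSet_lt measurable_const (hg.const_mul 2)) hg measurable_const
  have key := h F (ENNReal.ofReal (2 / l) • ν.withDensity φ) fun i hi => ?_
  · simpa [withDensity_apply _ MeasurableSet.univ] using key
  rw [Measure.smul_apply, withDensity_apply _ (hQ i), smul_eq_mul]
  have h1 : ENNReal.ofReal l * ν (Q i) ≤ ∫⁻ x in Q i, g x ∂ν := by
    have := (hF i hi).le
    rw [mul_comm _ (∫⁻ x in Q i, g x ∂ν), ← div_eq_mul_inv] at this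
    rwa [← ENNReal.le_div_iff_mul_le (Or.inl (h0 i)) (Or.inl (ht i))]
  have h2 : ∫⁻ x in Q i, g x ∂ν ≤ ∫⁻ x in Q i, φ x ∂ν + ENNReal.ofReal (l / 2) * ν (Q i) := by
    rw [← setLIntegral_const, ← lintegral_add_left hφm]
    refine lintegral_mono fun x => ?_
    simp only [hφ]
    split_ifs with hx
    · exact le_self_add
    · rw [zero_add, ENNReal.ofReal_div_of_pos two_pos, ENNReal.le_div_iff_mul_le] <;> simp_all
      rwa [mul_comm]
  have h3 : ENNReal.ofReal l = ENNReal.ofReal (l / 2) + ENNReal.ofReal (l / 2) := by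
    rw [← ENNReal.ofReal_add (by positivity) (by positivity)]; ring_nf
  rw [h3, add_mul] at h1
  have h4 : ENNReal.ofReal (l / 2) * ν (Q i) ≤ ∫⁻ x in Q i, φ x ∂ν :=
    (ENNReal.add_le_add_iff_right (ENNReal.mul_ne_top ofReal_ne_top (ht i))).1 (h1.trans h2)
  calc ν (Q i) = ENNReal.ofReal (2 / l) * (ENNReal.ofReal (l / 2) * ν (Q i)) := by
        rw [← mul_assoc, ← ENNReal.ofReal_mul (by positivity),
          show 2 / l * (l / 2) = 1 by field_simp, ENNReal.ofReal_one, one_mul]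
    _ ≤ _ := by gcongr

lemma HasWeakType.sum_rpow_le_aux {α ι : Type*} [MeasurableSpace α] {a : ι → ℝ≥0∞}
    {Q : ι → Set α} {ν : Measure α} [SFinite ν] {K : ℝ≥0∞} (h : HasWeakType a Q ν K)
    (hQ : ∀ i, MeasurableSet (Q i)) (h0 : ∀ i, ν (Q i) ≠ 0) (ht : ∀ i, ν (Q i) ≠ ∞)
    {g : α → ℝ≥0∞} (hg : Measurable g) {P : ℝ} (hP : 1 < P) (F : Finset ι) :
    ∑ i ∈ F, a i * ((ν (Q i))⁻¹ * ∫⁻ x in Q i, g x ∂ν) ^ P ≤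
      K * 2 ^ P * ENNReal.ofReal (P / (P - 1)) * ∫⁻ x, g x ^ P ∂ν := by
  classical
  set y : ι → ℝ≥0∞ := fun i => (ν (Q i))⁻¹ * ∫⁻ x in Q i, g x ∂ν with hy
  have hP0 : 0 < P := by linarith
  have hP1 : 0 < P - 1 := by linarith
  have hm : Measurable (Function.uncurry fun (l : ℝ) (x : α) =>
      ENNReal.ofReal (l ^ (P - 1 - 1)) * (if ENNReal.ofReal l < 2 * g x then g x else 0)) := by
    refine Measurable.mul (by fun_prop) (Measurable.ite ?_ (by fun_prop) measurable_const)
    exact measurableSet_lt (by fun_prop) (by fun_prop)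
  have e1 : ∀ i, y i ^ P = ENNReal.ofReal P * ∫⁻ l in Set.Ioi (0 : ℝ),
      (if ENNReal.ofReal l < y i then ENNReal.ofReal (l ^ (P - 1)) else 0) := by
    intro i
    rw [lintegral_layer hP0, ENNReal.mul_div_cancel (by simpa using hP0) ofReal_ne_top]
  have hm1 : ∀ i, Measurable fun l : ℝ =>
      if ENNReal.ofReal l < y i then ENNReal.ofReal (l ^ (P - 1)) else 0 := fun i =>
    Measurable.ite (measurableSet_lt (by fun_prop) measurable_const) (by fun_prop) measurable_const
  calc ∑ i ∈ F, a i * y i ^ P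
      = ENNReal.ofReal P * ∫⁻ l in Set.Ioi (0 : ℝ), ∑ i ∈ F,
          a i * (if ENNReal.ofReal l < y i then ENNReal.ofReal (l ^ (P - 1)) else 0) := by
        rw [lintegral_finsetSum _ fun i _ => (hm1 i).const_mul _, Finset.mul_sum]
        refine Finset.sum_congr rfl fun i _ => ?_
        rw [lintegral_const_mul _ (hm1 i), e1]
        ring
    _ ≤ ENNReal.ofReal P * ∫⁻ l in Set.Ioi (0 : ℝ), K * 2 * ∫⁻ x,
          ENNReal.ofReal (l ^ (P - 1 - 1)) *
            (if ENNReal.ofReal l < 2 * g x then g x else 0) ∂ν := by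
        gcongr ENNReal.ofReal P * ?_
        refine setLIntegral_mono' measurableSet_Ioi fun l hl => ?_
        have hl' : 0 < l := hl
        have h1 := h.sum_layer_le hQ h0 ht hg (F.filter fun i => ENNReal.ofReal l < y i) hl'
          fun i hi => (Finset.mem_filter.1 hi).2
        rw [lintegral_const_mul _ (Measurable.ite
          (measurableSet_lt measurable_const (hg.const_mul 2)) hg measurable_const)]
        · calc _ = ENNReal.ofReal (l ^ (P - 1)) * ∑ i ∈ F with ENNReal.ofReal l < y i, a i := by
                rw [Finset.sum_filter, Finset.mul_sum]
                refine Finset.sum_congr rfl fun i _ => ?_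
                split_ifs <;> ring
            _ ≤ _ := mul_le_mul_right h1 _
            _ = _ := by
                rw [show P - 1 = P - 1 - 1 + 1 by ring, Real.rpow_add_one hl'.ne',
                  ENNReal.ofReal_mul (by positivity), ENNReal.ofReal_div_of_pos hl',
                  show P - 1 - 1 + 1 - 1 = P - 1 - 1 by ring]
                have : ENNReal.ofReal l * (ENNReal.ofReal l)⁻¹ = 1 :=
                  ENNReal.mul_inv_cancel (by simpa using hl') ofReal_ne_top
                rw [div_eq_mul_inv, ENNReal.ofReal_ofNat]
                generalize (∫⁻ x, (if ENNReal.ofReal l < 2 * g x then g x else 0) ∂ν) = I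
                calc _ = (ENNReal.ofReal l * (ENNReal.ofReal l)⁻¹) *
                      (K * 2 * (ENNReal.ofReal (l ^ (P - 1 - 1)) * I)) := by ring
                  _ = _ := by rw [this, one_mul]
    _ = ENNReal.ofReal P * (K * 2 * ∫⁻ x, (∫⁻ l in Set.Ioi (0 : ℝ),
          ENNReal.ofReal (l ^ (P - 1 - 1)) *
            (if ENNReal.ofReal l < 2 * g x then g x else 0)) ∂ν) := by
        have hm' := hm.lintegral_prod_right' (ν := ν)
        simp only [Function.uncurry_apply_pair] at hm'
        rw [lintegral_const_mul _ hm', lintegral_lintegral_swap hm.aemeasurable]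
    _ = ENNReal.ofReal P * (K * 2 * ∫⁻ x, 2 ^ (P - 1) / ENNReal.ofReal (P - 1) * g x ^ P ∂ν) := by
        congr 3 with x
        calc _ = ∫⁻ l in Set.Ioi (0 : ℝ), g x *
              (if ENNReal.ofReal l < 2 * g x then ENNReal.ofReal (l ^ (P - 1 - 1)) else 0) := by
              congr 1 with l
              split_ifs <;> ring
          _ = g x * ((2 * g x) ^ (P - 1) / ENNReal.ofReal (P - 1)) := by
              rw [lintegral_const_mul, lintegral_layer hP1]
              exact Measurable.ite (measurableSet_lt (by fun_prop) measurable_const) (by fun_prop)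
                measurable_const
          _ = _ := by
              have : g x ^ P = g x ^ (P - 1) * g x := by
                conv_rhs => rw [← ENNReal.rpow_one (g x), ← ENNReal.rpow_mul, one_mul,
                  ← ENNReal.rpow_add_of_nonneg _ _ hP1.le zero_le_one, sub_add_cancel]
              rw [ENNReal.mul_rpow_of_nonneg _ _ hP1.le, this, div_eq_mul_inv, div_eq_mul_inv]
              ring
    _ = _ := by
        have : (2 : ℝ≥0∞) ^ P = 2 ^ (P - 1) * 2 := by
          conv_rhs => rw [← ENNReal.rpow_one 2, ← ENNReal.rpow_mul, one_mul,
            ← ENNReal.rpow_add_of_nonneg _ _ hP1.le zero_le_one, sub_add_cancel]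
        rw [lintegral_const_mul _ (by fun_prop), this, ENNReal.ofReal_div_of_pos hP1,
          div_eq_mul_inv, div_eq_mul_inv]
        ring

lemma average_rpow_le {α : Type*} [MeasurableSpace α] {ν : Measure α} {A : Set α}
    (h0 : ν A ≠ 0) (ht : ν A ≠ ∞) {g : α → ℝ≥0∞} (hg : Measurable g) {r : ℝ} (hr : 1 < r) :
    ((ν A)⁻¹ * ∫⁻ x in A, g x ∂ν) ^ r ≤ (ν A)⁻¹ * ∫⁻ x in A, g x ^ r ∂ν := by
  have hr0 : 0 < r := by linarith
  have hc := Real.HolderConjugate.conjExponent hr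
  have h1 := ENNReal.lintegral_mul_le_Lp_mul_Lq (ν.restrict A) hc hg.aemeasurable
    (g := fun _ => 1) aemeasurable_const
  simp only [Pi.mul_apply, mul_one, ENNReal.one_rpow, lintegral_const, one_mul,
    Measure.restrict_apply_univ] at h1
  calc _ ≤ ((ν A)⁻¹ * ((∫⁻ x in A, g x ^ r ∂ν) ^ (1 / r) * ν A ^ (1 / r.conjExponent))) ^ r := by
        gcongr
    _ = ((ν A)⁻¹ ^ r * ν A ^ (r - 1)) * ∫⁻ x in A, g x ^ r ∂ν := by
        rw [ENNReal.mul_rpow_of_nonneg _ _ hr0.le, ENNReal.mul_rpow_of_nonneg _ _ hr0.le,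
          ← ENNReal.rpow_mul, ← ENNReal.rpow_mul, one_div_mul_cancel hr0.ne', ENNReal.rpow_one]
        have : 1 / r.conjExponent * r = r - 1 := by
          rw [Real.conjExponent]; field_simp
        rw [this]; ring
    _ = _ := by
        congr 1
        rw [ENNReal.inv_rpow, ← ENNReal.rpow_neg, ← ENNReal.rpow_add _ _ h0 ht,
          ← ENNReal.rpow_neg_one]
        ring_nf

lemma HasWeakType.sum_rpow_le {α ι : Type*} [MeasurableSpace α] {a : ι → ℝ≥0∞}
    {Q : ι → Set α} {ν : Measure α} [SFinite ν] {K : ℝ≥0∞} (h : HasWeakType a Q ν K)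
    (hQ : ∀ i, MeasurableSet (Q i)) (h0 : ∀ i, ν (Q i) ≠ 0) (ht : ∀ i, ν (Q i) ≠ ∞)
    {g : α → ℝ≥0∞} (hg : Measurable g) {P : ℝ} (hP : 1 < P) (F : Finset ι) :
    ∑ i ∈ F, a i * ((ν (Q i))⁻¹ * ∫⁻ x in Q i, g x ∂ν) ^ P ≤
      8 * K * ENNReal.ofReal (P / (P - 1)) ^ P * ∫⁻ x, g x ^ P ∂ν := by
  have hP0 : 0 < P := by linarith
  have hP1 : 0 < P - 1 := by linarith
  have hone : 1 ≤ ENNReal.ofReal (P / (P - 1)) := by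
    rw [ENNReal.one_le_ofReal, one_le_div hP1]; linarith
  by_cases hP2 : P ≤ 2
  · refine (h.sum_rpow_le_aux hQ h0 ht hg hP F).trans ?_
    gcongr ?_ * _
    calc K * 2 ^ P * ENNReal.ofReal (P / (P - 1))
        ≤ K * 2 ^ (3 : ℝ) * ENNReal.ofReal (P / (P - 1)) ^ P := by
          gcongr
          · norm_num
          · linarith
          · conv_lhs => rw [← ENNReal.rpow_one (ENNReal.ofReal _)]
            exact ENNReal.rpow_le_rpow_of_exponent_le hone hP.le
      _ = _ := by rw [show (2 : ℝ≥0∞) ^ (3 : ℝ) = 8 by norm_cast]; ring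
  · push Not at hP2
    have h2 := h.sum_rpow_le_aux hQ h0 ht (hg.pow_const (P / 2)) one_lt_two F
    calc _ ≤ ∑ i ∈ F, a i * ((ν (Q i))⁻¹ * ∫⁻ x in Q i, g x ^ (P / 2) ∂ν) ^ (2 : ℝ) := by
          gcongr with i
          rw [show P = P / 2 * 2 by ring, ENNReal.rpow_mul, show P / 2 * 2 / 2 = P / 2 by ring]
          gcongr
          exact average_rpow_le (h0 i) (ht i) hg (by linarith)
      _ ≤ _ := h2
      _ ≤ _ := by
          simp only [← ENNReal.rpow_mul, show P / 2 * 2 = P by ring]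
          gcongr ?_ * _
          calc _ = 8 * K * 1 := by
                rw [show (2 : ℝ≥0∞) ^ (2 : ℝ) = 4 by norm_cast,
                  show ((2 : ℝ) / (2 - 1)) = 2 by norm_num, ENNReal.ofReal_ofNat]; ring_nf
            _ ≤ _ := by gcongr; exact ENNReal.one_le_rpow hone hP0

/-- Positive densities that are, together with their logarithm, integrable on a set `A`. -/
structure LogIntegrableOn {n : ℕ} (σ : (Fin n → ℝ) → ℝ) (A : Set (Fin n → ℝ)) : Prop where
  meas : Measurable σ
  pos : ∀ x, 0 < σ x
  int : IntegrableOn σ A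
  int_log : IntegrableOn (fun x => Real.log (σ x)) A

/-- The logarithm of the geometric mean of `σ` over `A`. -/
def logMean {n : ℕ} (σ : (Fin n → ℝ) → ℝ) (A : Set (Fin n → ℝ)) : ℝ :=
  ⨍ x in A, Real.log (σ x)

/-- The logarithm of the ratio of the arithmetic mean and the geometric mean. -/
def defect {n : ℕ} (σ : (Fin n → ℝ) → ℝ) (A : Set (Fin n → ℝ)) : ℝ :=
  Real.log (⨍ x in A, σ x) - logMean σ A

section

variable {n : ℕ} {σ : (Fin n → ℝ) → ℝ} {A : Set (Fin n → ℝ)}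

lemma LogIntegrableOn.integral_pos (h : LogIntegrableOn σ A) (h0 : volume A ≠ 0) :
    0 < ∫ x in A, σ x := by
  rw [integral_pos_iff_support_of_nonneg (fun x => (h.pos x).le) h.int]
  have : Function.support σ = Set.univ := by
    ext x; simp [(h.pos x).ne']
  rw [this, Measure.restrict_apply_univ]
  exact pos_iff_ne_zero.2 h0

lemma LogIntegrableOn.mean_pos (h : LogIntegrableOn σ A) (h0 : volume A ≠ 0) (ht : volume A ≠ ∞) :
    0 < ⨍ x in A, σ x := by
  rw [setAverage_eq]
  have : 0 < volume.real A := ENNReal.toReal_pos h0 ht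
  have := h.integral_pos h0
  simp only [smul_eq_mul]
  positivity

lemma LogIntegrableOn.log_le (h : LogIntegrableOn σ A) (h0 : volume A ≠ 0) (ht : volume A ≠ ∞)
    (x : Fin n → ℝ) :
    Real.log (σ x) - logMean σ A ≤ σ x / (⨍ x in A, σ x) - 1 + defect σ A := by
  have hS := h.mean_pos h0 ht
  have := Real.log_le_sub_one_of_pos (div_pos (h.pos x) hS)
  rw [Real.log_div (h.pos x).ne' hS.ne'] at this
  rw [defect]
  linarith

lemma LogIntegrableOn.defect_nonneg (h : LogIntegrableOn σ A) (h0 : volume A ≠ 0)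
    (ht : volume A ≠ ∞) : 0 ≤ defect σ A := by
  have hV : 0 < volume.real A := ENNReal.toReal_pos h0 ht
  have hS := h.mean_pos h0 ht
  have hmean : ∫ x in A, σ x = volume.real A * ⨍ x in A, σ x := by
    rw [setAverage_eq, smul_eq_mul, mul_inv_cancel_left₀ hV.ne']
  have hlog : ∫ x in A, Real.log (σ x) = volume.real A * logMean σ A := by
    rw [logMean, setAverage_eq, smul_eq_mul, mul_inv_cancel_left₀ hV.ne']
  have hc : ∀ c : ℝ, IntegrableOn (fun _ : Fin n → ℝ => c) A := fun c =>
    integrableOn_const ht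
  have key : ∫ x in A, (Real.log (σ x) - logMean σ A) ≤
      ∫ x in A, (σ x / (⨍ x in A, σ x) + (-1 + defect σ A)) := by
    refine integral_mono (h.int_log.sub (hc _)) ((h.int.div_const _).add (hc _)) fun x => ?_
    have := h.log_le h0 ht x
    simp only
    linarith
  rw [integral_sub h.int_log (hc _), integral_add (h.int.div_const _) (hc _), integral_div,
    setIntegral_const, setIntegral_const, hlog, hmean, mul_div_assoc, div_self hS.ne'] at key
  simp only [smul_eq_mul] at key
  have : 0 ≤ volume.real A * defect σ A := by linarith
  exact nonneg_of_mul_nonneg_right this hV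

/-- The geometric mean over `A` is controlled by the `L^{1/2}` mean over a large part of `A`. -/
lemma LogIntegrableOn.exp_logMean_le (h : LogIntegrableOn σ A) (h0 : volume A ≠ 0)
    (ht : volume A ≠ ∞) (hA : MeasurableSet A) {K : Set (Fin n → ℝ)} (hKA : K ⊆ A)
    (hK : MeasurableSet K)
    (hd : volume.real (A \ K) * (4 * (1 + defect σ A)) ≤ volume.real A) :
    ENNReal.ofReal (Real.exp (logMean σ A)) ≤
      64 * ((volume A)⁻¹ * ∫⁻ x in K, ENNReal.ofReal √(σ x)) ^ (2 : ℝ) := by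
  have hV : 0 < volume.real A := ENNReal.toReal_pos h0 ht
  have hS := h.mean_pos h0 ht
  have hL := h.defect_nonneg h0 ht
  set G := logMean σ A with hG
  set V := volume.real A with hVdef
  have hdK : MeasurableSet (A \ K) := hA.diff hK
  have hmean : ∫ x in A, σ x = V * ⨍ x in A, σ x := by
    rw [setAverage_eq, smul_eq_mul, mul_inv_cancel_left₀ hV.ne']
  have hlog : ∫ x in A, Real.log (σ x) = V * G := by
    rw [hG, logMean, setAverage_eq, smul_eq_mul, mul_inv_cancel_left₀ hV.ne']
  have hc : ∀ c : ℝ, IntegrableOn (fun _ : Fin n → ℝ => c) A := fun c => integrableOn_const ht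
  have hf : IntegrableOn (fun x => Real.log (σ x) - G) A := h.int_log.sub (hc _)
  have hVK : volume.real (A \ K) = V - volume.real K :=
    measureReal_sdiff hKA hK ht
  have htot : (∫ x in K, (Real.log (σ x) - G)) + ∫ x in A \ K, (Real.log (σ x) - G) = 0 := by
    rw [← setIntegral_union Set.disjoint_sdiff_right hdK (hf.mono_set hKA)
      (hf.mono_set Set.sdiff_subset), Set.union_sdiff_cancel hKA, integral_sub h.int_log (hc _),
      setIntegral_const, hlog, smul_eq_mul, sub_self]
  have hout : ∫ x in A \ K, (Real.log (σ x) - G) ≤ V + volume.real (A \ K) * defect σ A := by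
    have hfin_int : IntegrableOn (fun x => σ x / (⨍ x in A, σ x)) A := h.int.div_const _
    calc ∫ x in A \ K, (Real.log (σ x) - G)
        ≤ ∫ x in A \ K, (σ x / (⨍ x in A, σ x) + defect σ A) := by
          refine integral_mono (hf.mono_set Set.sdiff_subset)
            ((hfin_int.add (hc _)).mono_set Set.sdiff_subset) fun x => ?_
          have := h.log_le h0 ht x
          simp only
          linarith
      _ = (∫ x in A \ K, σ x / (⨍ x in A, σ x)) + volume.real (A \ K) * defect σ A := by
          rw [integral_add (hfin_int.mono_set Set.sdiff_subset) ((hc _).mono_set Set.sdiff_subset),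
            setIntegral_const, smul_eq_mul]
      _ ≤ (∫ x in A, σ x / (⨍ x in A, σ x)) + volume.real (A \ K) * defect σ A := by
          refine add_le_add (setIntegral_mono_set hfin_int ?_ Set.sdiff_subset.eventuallyLE) le_rfl
          exact Filter.Eventually.of_forall fun x => (div_pos (h.pos x) hS).le
      _ = _ := by rw [integral_div, hmean, mul_div_assoc, div_self hS.ne', mul_one]
  have hsq : IntegrableOn (fun x => √(σ x)) A := by
    refine Integrable.mono' (h.int.add (hc 1)) h.meas.sqrt.aestronglyMeasurable
      (Filter.Eventually.of_forall fun x => ?_)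
    rw [Real.norm_of_nonneg (Real.sqrt_nonneg _)]
    simp only [Pi.add_apply]
    nlinarith [Real.sq_sqrt (h.pos x).le, Real.sqrt_nonneg (σ x), sq_nonneg (√(σ x) - 1)]
  have hfK : IntegrableOn (fun x => (Real.log (σ x) - G) / 2) K := (hf.mono_set hKA).div_const 2
  have hlow : Real.exp (G / 2) * (V / 8) ≤ ∫ x in K, √(σ x) := by
    calc Real.exp (G / 2) * (V / 8)
        ≤ Real.exp (G / 2) * (volume.real K + (∫ x in K, (Real.log (σ x) - G)) / 2) := by
          gcongr
          have : 0 ≤ volume.real (A \ K) := measureReal_nonneg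
          nlinarith
      _ = ∫ x in K, Real.exp (G / 2) * (1 + (Real.log (σ x) - G) / 2) := by
          rw [integral_const_mul, integral_add ((hc 1).mono_set hKA)
            hfK, setIntegral_const, integral_div]
          simp
      _ ≤ _ := by
          refine integral_mono ((((hc 1).mono_set hKA).add hfK).const_mul _)
            (hsq.mono_set hKA) fun x => ?_
          have h1 : √(σ x) = Real.exp (G / 2) * Real.exp ((Real.log (σ x) - G) / 2) := by
            rw [← Real.exp_add, ← Real.exp_log (Real.sqrt_pos.2 (h.pos x)),
              Real.log_sqrt (h.pos x).le]
            ring_nf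
          simp only
          rw [h1]
          gcongr
          linarith [Real.add_one_le_exp ((Real.log (σ x) - G) / 2)]
  have hlow' : ENNReal.ofReal (Real.exp (G / 2) * (V / 8)) ≤ ∫⁻ x in K, ENNReal.ofReal √(σ x) := by
    rw [← ofReal_integral_eq_lintegral_ofReal (hsq.mono_set hKA)
      (Filter.Eventually.of_forall fun x => Real.sqrt_nonneg _)]
    exact ENNReal.ofReal_le_ofReal hlow
  have hVe : volume A = ENNReal.ofReal V := (ENNReal.ofReal_toReal ht).symm
  calc ENNReal.ofReal (Real.exp G)
      = 64 * ((volume A)⁻¹ * ENNReal.ofReal (Real.exp (G / 2) * (V / 8))) ^ (2 : ℝ) := by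
        rw [hVe, ← ENNReal.ofReal_inv_of_pos hV, ← ENNReal.ofReal_mul (by positivity),
          ENNReal.ofReal_rpow_of_nonneg (by positivity) (by norm_num),
          show (64 : ℝ≥0∞) = ENNReal.ofReal 64 by norm_num, ← ENNReal.ofReal_mul (by norm_num)]
        congr 1
        have : V⁻¹ * (Real.exp (G / 2) * (V / 8)) = Real.exp (G / 2) / 8 := by field_simp
        rw [this, Real.rpow_two, div_pow, ← Real.exp_nat_mul]
        push_cast
        ring_nf
    _ ≤ _ := by gcongr

end

/-- The lower (`0`), middle (`1`) and upper (`2`) parts of the interval `[c, c + h)`,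
where the lower and the upper part have length `ε * h`. -/
def segment (j : Fin 3) (c h ε : ℝ) : Set ℝ :=
  match j with
  | 0 => Set.Ico c (c + ε * h)
  | 1 => Set.Ico (c + ε * h) (c + h - ε * h)
  | 2 => Set.Ico (c + h - ε * h) (c + h)

lemma measurableSet_segment (j : Fin 3) (c h ε : ℝ) : MeasurableSet (segment j c h ε) := by
  fin_cases j <;> exact measurableSet_Ico

lemma exists_mem_segment {c h x : ℝ} (ε : ℝ) (hx : c ≤ x ∧ x < c + h) :
    ∃ j, x ∈ segment j c h ε := by
  by_cases h1 : x < c + ε * h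
  · exact ⟨0, hx.1, h1⟩
  · by_cases h2 : x < c + h - ε * h
    · exact ⟨1, not_lt.1 h1, h2⟩
    · exact ⟨2, not_lt.1 h2, hx.2⟩

lemma segment_subset {j : Fin 3} {c h ε : ℝ} (hh : 0 < h) (h0 : 0 ≤ ε) (h1 : ε ≤ 1 / 4) :
    segment j c h ε ⊆ Set.Ico c (c + h) := by
  intro x hx
  have := mul_nonneg h0 hh.le
  have : ε * h ≤ 1 / 4 * h := by gcongr
  fin_cases j <;> obtain ⟨h2, h3⟩ := hx <;> constructor <;> linarith

lemma segment_overlap {j : Fin 3} {c h ε c' h' ε' x y : ℝ} (hh : 0 < h) (hh' : 0 < h')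
    (h1 : ε ≤ 1 / 4) (h0' : 0 ≤ ε') (h1' : ε' ≤ 1 / 4)
    (hx : x ∈ segment j c h ε) (hx' : x ∈ segment j c' h' ε') (hle : h' ≤ ε * h)
    (hy : c' + (if j = 0 then ε' * h' else 0) ≤ y ∧
      y < c' + (if j = 0 then ε' * h' else 0) + (1 - ε') * h') :
    (c ≤ y ∧ y < c + h) ∧ (c' ≤ y ∧ y < c' + h') := by
  have e1 : ε * h ≤ 1 / 4 * h := by gcongr
  have e2 : ε' * h' ≤ 1 / 4 * h' := by gcongr
  have e3 := mul_nonneg h0' hh'.le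
  have e4 : (1 - ε') * h' = h' - ε' * h' := by ring
  rw [e4] at hy
  fin_cases j <;> obtain ⟨h2, h3⟩ := hx <;> obtain ⟨h2', h3'⟩ := hx' <;> obtain ⟨h4, h5⟩ := hy <;>
    simp at h4 h5 <;> refine ⟨⟨?_, ?_⟩, ?_, ?_⟩ <;> linarith

/-- The part of the cube with corner `c` and side `h` that is of type `J`. -/
def core {n : ℕ} (J : Fin n → Fin 3) (c : Fin n → ℝ) (h ε : ℝ) : Set (Fin n → ℝ) :=
  Set.univ.pi fun k => segment (J k) (c k) h ε

lemma measurableSet_core {n : ℕ} (J : Fin n → Fin 3) (c : Fin n → ℝ) (h ε : ℝ) :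
    MeasurableSet (core J c h ε) :=
  MeasurableSet.univ_pi fun _ => measurableSet_segment _ _ _ _

lemma core_subset {n : ℕ} {J : Fin n → Fin 3} {c : Fin n → ℝ} {h ε : ℝ} (hh : 0 < h) (h0 : 0 ≤ ε)
    (h1 : ε ≤ 1 / 4) : core J c h ε ⊆ box c h :=
  Set.pi_mono fun _ _ => segment_subset hh h0 h1

lemma box_subset_iUnion_core {n : ℕ} (c : Fin n → ℝ) (h ε : ℝ) :
    box c h ⊆ ⋃ J : Fin n → Fin 3, core J c h ε := by
  intro x hx
  choose J hJ using fun k => exists_mem_segment ε (mem_box.1 hx k)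
  exact Set.mem_iUnion.2 ⟨J, fun k _ => hJ k⟩

lemma volume_sdiff_le_of_core {n : ℕ} {J : Fin n → Fin 3} {c c' x : Fin n → ℝ} {h h' ε ε' : ℝ}
    (hh : 0 < h) (hh' : 0 < h') (h1 : ε ≤ 1 / 4) (h0' : 0 ≤ ε') (h1' : ε' ≤ 1 / 4)
    (hx : x ∈ core J c h ε) (hx' : x ∈ core J c' h' ε') (hle : h' ≤ ε * h) :
    volume.real (box c' h' \ box c h) ≤ n * ε' * volume.real (box c' h') := by
  set R := box (fun k => c' k + if J k = 0 then ε' * h' else 0) ((1 - ε') * h') with hR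
  have hRs : R ⊆ box c h ∩ box c' h' := by
    intro y hy
    have := fun k => segment_overlap hh hh' h1 h0' h1' (hx k trivial) (hx' k trivial) hle
      (mem_box.1 hy k)
    exact ⟨mem_box.2 fun k => (this k).1, mem_box.2 fun k => (this k).2⟩
  have hvol : ∀ (c : Fin n → ℝ) {h : ℝ}, 0 ≤ h → volume.real (box c h) = h ^ n := by
    intro c h hh
    rw [Measure.real, volume_box, ENNReal.toReal_pow, ENNReal.toReal_ofReal hh]
  have hfin : volume (box c' h') ≠ ∞ := by rw [volume_box]; exact pow_ne_top ofReal_ne_top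
  calc volume.real (box c' h' \ box c h) ≤ volume.real (box c' h' \ R) :=
        measureReal_mono (Set.sdiff_subset_sdiff_right (hRs.trans Set.inter_subset_left))
          (measure_ne_top_of_subset Set.sdiff_subset hfin)
    _ = h' ^ n - ((1 - ε') * h') ^ n := by
        rw [measureReal_sdiff (hRs.trans Set.inter_subset_right) (measurableSet_box _ _) hfin,
          hvol _ hh'.le, hvol _ (mul_nonneg (by linarith) hh'.le)]
    _ ≤ n * ε' * volume.real (box c' h') := by
        have hb := one_add_mul_le_pow (a := -ε') (by linarith) n
        rw [hvol _ hh'.le, mul_pow]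
        have : 0 < h' ^ n := by positivity
        rw [show 1 + -ε' = 1 - ε' by ring] at hb
        nlinarith

/-- The measure with density `σ`. -/
def densityMeasure {n : ℕ} (σ : (Fin n → ℝ) → ℝ) : Measure (Fin n → ℝ) :=
  volume.withDensity fun x => ENNReal.ofReal (σ x)

instance {n : ℕ} (σ : (Fin n → ℝ) → ℝ) : SFinite (densityMeasure σ) := by
  unfold densityMeasure; infer_instance

section

variable {n : ℕ} {σ : (Fin n → ℝ) → ℝ} {A : Set (Fin n → ℝ)}

lemma LogIntegrableOn.densityMeasure_eq (h : LogIntegrableOn σ A) (h0 : volume A ≠ 0)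
    (ht : volume A ≠ ∞) (hA : MeasurableSet A) :
    densityMeasure σ A = volume A * ENNReal.ofReal (⨍ x in A, σ x) := by
  have hV : 0 < volume.real A := ENNReal.toReal_pos h0 ht
  rw [densityMeasure, withDensity_apply _ hA, ← ofReal_integral_eq_lintegral_ofReal h.int
    (Filter.Eventually.of_forall fun x => (h.pos x).le), setAverage_eq, smul_eq_mul,
    ENNReal.ofReal_mul (by positivity), ENNReal.ofReal_inv_of_pos hV, Measure.real,
    ENNReal.ofReal_toReal ht, ENNReal.mul_inv_cancel_left h0 ht]

lemma LogIntegrableOn.volume_mul_exp_logMean (h : LogIntegrableOn σ A) (h0 : volume A ≠ 0)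
    (ht : volume A ≠ ∞) (hA : MeasurableSet A) :
    volume A * ENNReal.ofReal (Real.exp (logMean σ A)) =
      densityMeasure σ A * ENNReal.ofReal (Real.exp (-defect σ A)) := by
  have hS := h.mean_pos h0 ht
  rw [h.densityMeasure_eq h0 ht hA, mul_assoc, ← ENNReal.ofReal_mul hS.le, defect]
  congr 2
  rw [neg_sub, Real.exp_sub, Real.exp_log hS, mul_div_cancel₀ _ hS.ne']

end

open Classical in
lemma SparseBoxes.sum_exp_logMean_le_of_core {n : ℕ} {ι : Type*} (B : SparseBoxes n ι)
    {σ : (Fin n → ℝ) → ℝ} (hσ : ∀ i, LogIntegrableOn σ (B.Q i)) (J : Fin n → Fin 3)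
    (F : Finset ι) (μ : Measure (Fin n → ℝ)) (M : ℝ≥0∞)
    (hμ : ∀ i ∈ F, densityMeasure σ (B.Q i) ≤
      M * μ (core J (B.corner i) (B.side i) (smallness n (defect σ (B.Q i))))) :
    ∑ i ∈ F, volume (B.Q i) * ENNReal.ofReal (Real.exp (logMean σ (B.Q i))) ≤
      M * (8192 * 5 ^ n + 32 * (n + 1) * 4 ^ n) * μ Set.univ := by
  set L : ι → ℝ := fun i => defect σ (B.Q i) with hLdef
  set ε : ι → ℝ := fun i => smallness n (L i) with hε
  set A : ι → Set (Fin n → ℝ) := fun i => core J (B.corner i) (B.side i) (ε i) with hA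
  have hL : ∀ i, 0 ≤ L i := fun i =>
    (hσ i).defect_nonneg (B.volume_Q_ne_zero i) (B.volume_Q_ne_top i)
  have hε0 : ∀ i, 0 < ε i := fun i => smallness_pos n (hL i)
  have hε1 : ∀ i, ε i ≤ 1 / 4 := fun i => smallness_le n (hL i)
  have hAm : ∀ i, MeasurableSet (A i) := fun i => measurableSet_core _ _ _ _
  have hAQ : ∀ i, A i ⊆ B.Q i := fun i => core_subset (B.side_pos i) (hε0 i).le (hε1 i)
  obtain ⟨S, hSF, D, hDm, hDA, hdisj, hD2, hcov⟩ :=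
    exists_selection μ A hAm (fun i => ε i * B.side i) F
  have hDsum : ∑ s ∈ S, μ (D s) ≤ μ Set.univ := by
    rw [← measure_biUnion_finset hdisj fun s _ => hDm s]
    exact measure_mono (Set.subset_univ _)
  set p : ι → Prop := fun i => ∃ s ∈ S, (A i ∩ A s).Nonempty ∧ B.side i ≤ ε s * B.side s with hp
  have habs : ∑ i ∈ F with p i, volume (B.Q i) * ENNReal.ofReal (Real.exp (logMean σ (B.Q i))) ≤
      M * (8192 * 5 ^ n) * μ Set.univ := by
    set V := ⋃ s ∈ S, B.Q s with hV
    have hVm : MeasurableSet V := S.measurableSet_biUnion fun s _ => B.measurableSet_Q s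
    have hσm : Measurable σ ∨ IsEmpty ι := by
      rcases isEmpty_or_nonempty ι with h | ⟨⟨i⟩⟩
      · exact Or.inr h
      · exact Or.inl (hσ i).meas
    rcases hσm with hσm | hemp
    swap
    · simp [Finset.eq_empty_of_isEmpty]
    set φ : (Fin n → ℝ) → ℝ≥0∞ := V.indicator fun x => ENNReal.ofReal √(σ x) with hφ
    have hφm : Measurable φ := hσm.sqrt.ennreal_ofReal.indicator hVm
    have hone : ∀ i ∈ F.filter p, ENNReal.ofReal (Real.exp (logMean σ (B.Q i))) ≤
        64 * ((volume (B.Q i))⁻¹ * ∫⁻ x in B.Q i, φ x) ^ (2 : ℝ) := by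
      intro i hi
      obtain ⟨s, hs, ⟨x, hxi, hxs⟩, hle⟩ := (Finset.mem_filter.1 hi).2
      have hd := volume_sdiff_le_of_core (B.side_pos s) (B.side_pos i) (hε1 s)
        (hε0 i).le (hε1 i) hxs hxi hle
      have h1 := (hσ i).exp_logMean_le (B.volume_Q_ne_zero i) (B.volume_Q_ne_top i)
        (B.measurableSet_Q i) (K := B.Q i ∩ V) Set.inter_subset_left
        ((B.measurableSet_Q i).inter hVm) ?_
      · rwa [hφ, setLIntegral_indicator hVm, Set.inter_comm V]
      · have hsub : B.Q i \ (B.Q i ∩ V) ⊆ B.Q i \ B.Q s := by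
          rw [Set.sdiff_self_inter]
          exact Set.sdiff_subset_sdiff_right (Set.subset_biUnion_of_mem (u := B.Q) hs)
        have h2 : volume.real (B.Q i \ (B.Q i ∩ V)) ≤ n * ε i * volume.real (B.Q i) :=
          (measureReal_mono hsub
            (measure_ne_top_of_subset Set.sdiff_subset (B.volume_Q_ne_top i))).trans hd
        have h3 : (n : ℝ) * ε i * (4 * (1 + L i)) ≤ 1 := by
          have := hL i
          simp only [hε, smallness]
          rw [mul_one_div, div_mul_eq_mul_div, div_le_one (by positivity)]
          nlinarith
        calc _ ≤ n * ε i * volume.real (B.Q i) * (4 * (1 + L i)) := by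
              have := hL i
              gcongr
          _ = (n * ε i * (4 * (1 + L i))) * volume.real (B.Q i) := by ring
          _ ≤ 1 * volume.real (B.Q i) := by gcongr
          _ = _ := one_mul _
    have hmax := B.hasWeakType_volume.sum_rpow_le B.measurableSet_Q B.volume_Q_ne_zero
      B.volume_Q_ne_top hφm one_lt_two (F.filter p)
    have hφ2 : ∫⁻ x, φ x ^ (2 : ℝ) = densityMeasure σ V := by
      rw [densityMeasure, withDensity_apply _ hVm, ← lintegral_indicator hVm]
      congr 1 with x
      by_cases hx : x ∈ V
      · rw [hφ, Set.indicator_of_mem hx, Set.indicator_of_mem hx,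
          ENNReal.ofReal_rpow_of_nonneg (Real.sqrt_nonneg _) (by norm_num), Real.rpow_two,
          Real.sq_sqrt]
        by_cases hne : Nonempty ι
        · exact ((hσ hne.some).pos x).le
        · simp only [hV] at hx
          obtain ⟨s, -⟩ := Set.mem_iUnion.1 hx
          exact absurd ⟨s⟩ hne
      · rw [hφ, Set.indicator_of_notMem hx, Set.indicator_of_notMem hx]
        simp
    have hVle : densityMeasure σ V ≤ M * 2 * μ Set.univ := by
      calc densityMeasure σ V ≤ ∑ s ∈ S, densityMeasure σ (B.Q s) := measure_biUnion_finset_le _ _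
        _ ≤ ∑ s ∈ S, M * 2 * μ (D s) := Finset.sum_le_sum fun s hs => by
            refine (hμ s (hSF hs)).trans ?_
            rw [mul_assoc]
            exact mul_le_mul_right (hD2 s hs) _
        _ ≤ _ := by rw [← Finset.mul_sum]; gcongr
    calc _ ≤ ∑ i ∈ F with p i, 64 * (volume (B.Q i) *
          ((volume (B.Q i))⁻¹ * ∫⁻ x in B.Q i, φ x) ^ (2 : ℝ)) :=
          Finset.sum_le_sum fun i hi => by
            rw [mul_left_comm]
            exact mul_le_mul_right (hone i hi) _
      _ ≤ 64 * (8 * (2 * 5 ^ n) * ENNReal.ofReal (2 / (2 - 1)) ^ (2 : ℝ) *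
            (M * 2 * μ Set.univ)) := by
          rw [← Finset.mul_sum]
          gcongr 64 * ?_
          rw [hφ2] at hmax
          exact hmax.trans (by gcongr)
      _ = _ := by
          rw [show ((2 : ℝ) / (2 - 1)) = 2 by norm_num, ENNReal.ofReal_ofNat,
            show (2 : ℝ≥0∞) ^ (2 : ℝ) = 4 by norm_cast]
          ring
  have hnon : ∑ i ∈ F with ¬ p i,
      volume (B.Q i) * ENNReal.ofReal (Real.exp (logMean σ (B.Q i))) ≤
      M * (32 * (n + 1) * 4 ^ n) * μ Set.univ := by
    set w : ι → ℝ≥0∞ := fun i => ENNReal.ofReal (Real.exp (-L i)) with hw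
    have hterm : ∀ i ∈ F.filter fun i => ¬ p i,
        volume (B.Q i) * ENNReal.ofReal (Real.exp (logMean σ (B.Q i))) ≤
        M * 2 * ∑ s ∈ S, if ε i * B.side i ≤ ε s * B.side s ∧ ε s * B.side s ≤ B.side i
          then w i * μ (A i ∩ D s) else 0 := by
      intro i hi
      obtain ⟨hiF, hpi⟩ := Finset.mem_filter.1 hi
      rw [(hσ i).volume_mul_exp_logMean (B.volume_Q_ne_zero i) (B.volume_Q_ne_top i)
        (B.measurableSet_Q i)]
      calc densityMeasure σ (B.Q i) * w i
          ≤ M * (2 * ∑ s ∈ S with ε i * B.side i ≤ ε s * B.side s, μ (A i ∩ D s)) * w i := by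
            gcongr
            exact (hμ i hiF).trans (mul_le_mul_right (hcov i hiF) _)
        _ = M * 2 * ∑ s ∈ S, if ε i * B.side i ≤ ε s * B.side s
              then w i * μ (A i ∩ D s) else 0 := by
            rw [← Finset.sum_filter, ← Finset.mul_sum]
            ring
        _ ≤ _ := by
            gcongr M * 2 * ?_
            refine Finset.sum_le_sum fun s hs => ?_
            by_cases h1 : ε i * B.side i ≤ ε s * B.side s
            · by_cases h2 : ε s * B.side s ≤ B.side i
              · simp [h1, h2]
              · have : A i ∩ D s = ∅ := by
                  by_contra hne
                  refine hpi ⟨s, hs, ?_, (not_le.1 h2).le⟩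
                  exact (Set.nonempty_iff_ne_empty.2 hne).mono
                    (Set.inter_subset_inter_right _ (hDA s))
                simp [this]
            · simp [h1]
    calc _ ≤ ∑ i ∈ F with ¬ p i, M * 2 * ∑ s ∈ S,
          (if ε i * B.side i ≤ ε s * B.side s ∧ ε s * B.side s ≤ B.side i
            then w i * μ (A i ∩ D s) else 0) := Finset.sum_le_sum hterm
      _ = M * 2 * ∑ s ∈ S, ∑ i ∈ (F.filter fun i => ¬ p i) with
            ε i * B.side i ≤ ε s * B.side s ∧ ε s * B.side s ≤ B.side i,
            w i * μ (A i ∩ D s) := by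
          rw [← Finset.mul_sum, Finset.sum_comm]
          simp only [Finset.sum_filter _ (fun i => w i * _)]
      _ ≤ M * 2 * ∑ s ∈ S, 16 * (n + 1) * 4 ^ n * μ (D s) := by
          gcongr M * 2 * ?_
          refine Finset.sum_le_sum fun s hs => ?_
          set T := (F.filter fun i => ¬ p i).filter fun i =>
            ε i * B.side i ≤ ε s * B.side s ∧ ε s * B.side s ≤ B.side i with hT
          have hfin_int : ∀ i, w i * μ (A i ∩ D s) =
              ∫⁻ x in D s, (if x ∈ A i then w i else 0) ∂μ := by
            intro i
            rw [← Measure.restrict_apply (hAm i), ← lintegral_indicator_const (hAm i)]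
            rfl
          calc ∑ i ∈ T, w i * μ (A i ∩ D s)
              = ∫⁻ x in D s, ∑ i ∈ T, (if x ∈ A i then w i else 0) ∂μ := by
                have hm : ∀ i, Measurable fun x => if x ∈ A i then w i else 0 := fun i =>
                  Measurable.ite (hAm i) measurable_const measurable_const
                rw [lintegral_finsetSum _ fun i _ => hm i]
                exact Finset.sum_congr rfl fun i _ => hfin_int i
            _ ≤ ∫⁻ x in D s, 16 * (n + 1) * 4 ^ n ∂μ := by
                refine lintegral_mono fun x => ?_
                rw [← Finset.sum_filter]
                refine B.sum_exp_le hL _ x (t := ε s * B.side s)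
                  (mul_pos (hε0 s) (B.side_pos s)) fun i hi => ?_
                obtain ⟨hiT, hx⟩ := Finset.mem_filter.1 hi
                exact ⟨hAQ i hx, (Finset.mem_filter.1 hiT).2⟩
            _ = _ := setLIntegral_const _ _
      _ ≤ M * 2 * (16 * (n + 1) * 4 ^ n * μ Set.univ) := by
          rw [← Finset.mul_sum]
          gcongr
      _ = _ := by ring
  rw [← Finset.sum_filter_add_sum_filter_not F p]
  calc _ ≤ _ := add_le_add habs hnon
    _ = _ := by ring

/-- The constant in the weak-type estimate for geometric means. -/
def weakConst (n : ℕ) : ℝ≥0∞ := 3 ^ n * (3 ^ n * (8192 * 5 ^ n + 32 * (n + 1) * 4 ^ n))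

lemma SparseBoxes.hasWeakType_logMean {n : ℕ} {ι : Type*} (B : SparseBoxes n ι)
    {σ : (Fin n → ℝ) → ℝ} (hσ : ∀ i, LogIntegrableOn σ (B.Q i)) :
    HasWeakType (fun i => volume (B.Q i) * ENNReal.ofReal (Real.exp (logMean σ (B.Q i))))
      B.Q (densityMeasure σ) (weakConst n) := by
  classical
  intro F μ hF
  have hcard : (Finset.univ : Finset (Fin n → Fin 3)).card = 3 ^ n := by simp
  have hex : ∀ i ∈ F, ∃ J : Fin n → Fin 3, densityMeasure σ (B.Q i) ≤
      3 ^ n * μ (core J (B.corner i) (B.side i) (smallness n (defect σ (B.Q i)))) := by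
    intro i hi
    obtain ⟨J, -, hJ⟩ := Finset.exists_max_image Finset.univ (fun J : Fin n → Fin 3 =>
      μ (core J (B.corner i) (B.side i) (smallness n (defect σ (B.Q i))))) Finset.univ_nonempty
    refine ⟨J, (hF i hi).trans ((measure_mono (box_subset_iUnion_core _ _
      (smallness n (defect σ (B.Q i))))).trans ((measure_iUnion_fintype_le _ _).trans ?_))⟩
    refine (Finset.sum_le_card_nsmul _ _ _ hJ).trans ?_
    rw [hcard, nsmul_eq_mul]
    push_cast
    exact le_rfl
  calc ∑ i ∈ F, volume (B.Q i) * ENNReal.ofReal (Real.exp (logMean σ (B.Q i)))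
      ≤ ∑ J : Fin n → Fin 3, ∑ i ∈ F with densityMeasure σ (B.Q i) ≤
          3 ^ n * μ (core J (B.corner i) (B.side i) (smallness n (defect σ (B.Q i)))),
          volume (B.Q i) * ENNReal.ofReal (Real.exp (logMean σ (B.Q i))) := by
        simp only [Finset.sum_filter]
        rw [Finset.sum_comm]
        refine Finset.sum_le_sum fun i hi => ?_
        obtain ⟨J, hJ⟩ := hex i hi
        refine le_trans ?_ (Finset.single_le_sum (fun _ _ => zero_le) (Finset.mem_univ J))
        rw [if_pos hJ]
    _ ≤ ∑ J : Fin n → Fin 3, 3 ^ n * (8192 * 5 ^ n + 32 * (n + 1) * 4 ^ n) * μ Set.univ :=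
        Finset.sum_le_sum fun J _ => B.sum_exp_logMean_le_of_core hσ J _ μ _
          fun i hi => (Finset.mem_filter.1 hi).2
    _ = _ := by
        rw [Finset.sum_const, hcard, nsmul_eq_mul, weakConst]
        push_cast
        ring

/-- The density `w ^ (-1/τ)` associated with a weight `w`. -/
def dualDensity {n : ℕ} (τ : ℝ) (w : (Fin n → ℝ) → ℝ) (x : Fin n → ℝ) : ℝ := w x ^ (-1 / τ)

lemma IsWeight.dualDensity_pos {n : ℕ} {w : (Fin n → ℝ) → ℝ} (hw : IsWeight w) (τ : ℝ)
    (x : Fin n → ℝ) : 0 < dualDensity τ w x := Real.rpow_pos_of_pos (hw.2 x) _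

lemma IsWeight.measurable_dualDensity {n : ℕ} {w : (Fin n → ℝ) → ℝ} (hw : IsWeight w) (τ : ℝ) :
    Measurable (dualDensity τ w) := hw.1.pow_const _

lemma IsWeight.mul_log_dualDensity {n : ℕ} {w : (Fin n → ℝ) → ℝ} (hw : IsWeight w) {τ : ℝ}
    (hτ : 0 < τ) (x : Fin n → ℝ) : τ * Real.log (dualDensity τ w x) = -Real.log (w x) := by
  rw [dualDensity, Real.log_rpow (hw.2 x)]
  field_simp

lemma IsWeight.avg_inv {n : ℕ} {w : (Fin n → ℝ) → ℝ} (hw : IsWeight w) {τ : ℝ} (hτ : 0 < τ)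
    (Q : Set (Fin n → ℝ)) : avg τ (fun x => (w x)⁻¹) Q =
      ((volume Q)⁻¹ * ∫⁻ x in Q, ENNReal.ofReal (dualDensity τ w x)) ^ τ := by
  rw [avg, if_neg hτ.ne']
  congr 3 with x
  have h := inv_pos.2 (hw.2 x)
  rw [abs_of_pos h, ENNReal.ofReal_rpow_of_pos h, dualDensity, Real.inv_rpow (hw.2 x).le,
    ← Real.rpow_neg (hw.2 x).le, neg_div]

lemma ne_top_of_prod_ne_top {ι : Type*} [Fintype ι] [DecidableEq ι] {a : ι → ℝ≥0∞}
    (h0 : ∀ i, a i ≠ 0) (h : ∏ i, a i ≠ ∞) (i : ι) : a i ≠ ∞ := by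
  intro hi
  rw [← Finset.mul_prod_erase _ _ (Finset.mem_univ i), hi,
    ENNReal.top_mul (Finset.prod_ne_zero_iff.2 fun j _ => h0 j)] at h
  exact h rfl

section

variable {n m : ℕ} {τ : Fin m → ℝ} {w : Fin m → (Fin n → ℝ) → ℝ}

lemma sum_mul_log_dualDensity (hw : ∀ j, IsWeight (w j)) (hτ : ∀ j, 0 < τ j)
    (hprod : ∀ x, ∏ j, w j x = 1) (x : Fin n → ℝ) :
    ∑ j, τ j * Real.log (dualDensity (τ j) (w j) x) = 0 := by
  simp only [fun j => (hw j).mul_log_dualDensity (hτ j) x]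
  rw [Finset.sum_neg_distrib, ← Real.log_prod fun j _ => ((hw j).2 x).ne', hprod, Real.log_one,
    neg_zero]

lemma logIntegrableOn_dualDensity (hw : ∀ j, IsWeight (w j)) (hτ : ∀ j, 0 < τ j)
    (hprod : ∀ x, ∏ j, w j x = 1) {Q : Set (Fin n → ℝ)} (h0 : volume Q ≠ 0) (ht : volume Q ≠ ∞)
    (hQ : ∏ j, avg (τ j) (fun x => (w j x)⁻¹) Q ≠ ∞) (j : Fin m) :
    LogIntegrableOn (dualDensity (τ j) (w j)) Q := by
  have hne : ∀ j, (volume Q)⁻¹ * ∫⁻ x in Q, ENNReal.ofReal (dualDensity (τ j) (w j) x) ≠ 0 := by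
    intro j
    refine mul_ne_zero (ENNReal.inv_ne_zero.2 ht) ?_
    intro h
    rw [lintegral_eq_zero_iff ((hw j).measurable_dualDensity _).ennreal_ofReal] at h
    have : ∀ᵐ x ∂volume.restrict Q, False := by
      filter_upwards [h] with x hx
      have := (hw j).dualDensity_pos (τ j) x
      simp only [Pi.zero_apply, ENNReal.ofReal_eq_zero] at hx
      linarith
    simp [h0] at this
  have hfin_int : ∀ j, IntegrableOn (dualDensity (τ j) (w j)) Q := by
    intro j
    have h1 := ne_top_of_prod_ne_top (fun j => ?_) hQ j
    · rw [(hw j).avg_inv (hτ j)] at h1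
      have h2 : ∫⁻ x in Q, ENNReal.ofReal (dualDensity (τ j) (w j) x) ≠ ∞ := by
        intro h
        rw [h, ENNReal.mul_top (ENNReal.inv_ne_zero.2 ht), ENNReal.top_rpow_of_pos (hτ j)] at h1
        exact h1 rfl
      exact (lintegral_ofReal_ne_top_iff_integrable
        ((hw j).measurable_dualDensity _).aestronglyMeasurable
        (Filter.Eventually.of_forall fun x => ((hw j).dualDensity_pos _ x).le)).1 h2
    · rw [(hw j).avg_inv (hτ j)]
      exact (ENNReal.rpow_pos_of_nonneg (pos_iff_ne_zero.2 (hne j)) (hτ j).le).ne'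
  refine ⟨(hw j).measurable_dualDensity _, (hw j).dualDensity_pos _, hfin_int j, ?_⟩
  refine Integrable.mono' (g := fun x => dualDensity (τ j) (w j) x +
    (τ j)⁻¹ * ∑ i, τ i * dualDensity (τ i) (w i) x) ?_
    ((hw j).measurable_dualDensity _).log.aestronglyMeasurable
    (Filter.Eventually.of_forall fun x => ?_)
  · exact (hfin_int j).add ((integrable_finsetSum _ fun i _ => (hfin_int i).const_mul _).const_mul _)
  · have hlog : ∀ i, Real.log (dualDensity (τ i) (w i) x) ≤ dualDensity (τ i) (w i) x :=
      fun i => Real.log_le_self ((hw i).dualDensity_pos _ x).le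
    have hpos : ∀ i, 0 < dualDensity (τ i) (w i) x := fun i => (hw i).dualDensity_pos _ x
    have hj := hτ j
    have hs : 0 ≤ ∑ i, τ i * dualDensity (τ i) (w i) x :=
      Finset.sum_nonneg fun i _ => mul_nonneg (hτ i).le (hpos i).le
    rw [Real.norm_eq_abs, abs_le]
    constructor
    · have hsum := sum_mul_log_dualDensity hw hτ hprod x
      rw [← Finset.add_sum_erase _ _ (Finset.mem_univ j)] at hsum
      have h1 : ∑ i ∈ Finset.univ.erase j, τ i * Real.log (dualDensity (τ i) (w i) x) ≤
          ∑ i, τ i * dualDensity (τ i) (w i) x := by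
        refine (Finset.sum_le_sum fun i _ => mul_le_mul_of_nonneg_left (hlog i) (hτ i).le).trans ?_
        exact Finset.sum_le_sum_of_subset_of_nonneg (Finset.erase_subset _ _)
          fun i _ _ => mul_nonneg (hτ i).le (hpos i).le
      have h2 : -Real.log (dualDensity (τ j) (w j) x) ≤
          (τ j)⁻¹ * ∑ i, τ i * dualDensity (τ i) (w i) x := by
        rw [inv_mul_eq_div, le_div_iff₀ hj]
        linarith
      linarith [hpos j]
    · have : 0 ≤ (τ j)⁻¹ * ∑ i, τ i * dualDensity (τ i) (w i) x :=
        mul_nonneg (inv_nonneg.2 hj.le) hs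
      linarith [hlog j]

end

/-- Exchanging arithmetic means for geometric means in a product of averages. -/
lemma sum_mul_le_of_sum_eq_zero {ι : Type*} [Fintype ι] {ρ q s g : ι → ℝ} {γ : ℝ}
    (hγ : ∀ j, ρ j ≤ γ * (ρ j - q j)) (hsg : ∀ j, g j ≤ s j)
    (h0 : ∑ j, (ρ j - q j) * g j = 0) :
    ∑ j, ρ j * s j ≤ γ * ∑ j, (ρ j - q j) * s j + ∑ j, q j * g j := by
  have h1 : ∑ j, (γ * (ρ j - q j) - ρ j) * g j ≤ ∑ j, (γ * (ρ j - q j) - ρ j) * s j :=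
    Finset.sum_le_sum fun j _ => mul_le_mul_of_nonneg_left (hsg j) (sub_nonneg.2 (hγ j))
  have h2 : ∀ t : ι → ℝ, ∑ j, (γ * (ρ j - q j) - ρ j) * t j =
      γ * ∑ j, (ρ j - q j) * t j - ∑ j, ρ j * t j := by
    intro t
    rw [Finset.mul_sum, ← Finset.sum_sub_distrib]
    exact Finset.sum_congr rfl fun j _ => by ring
  have h3 : ∑ j, ρ j * g j = ∑ j, q j * g j := by
    rw [← sub_eq_zero, ← Finset.sum_sub_distrib, ← h0]
    exact Finset.sum_congr rfl fun j _ => by ring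
  rw [h2, h2, h0, h3] at h1
  linarith

lemma prod_ofReal_exp_rpow {ι : Type*} [Fintype ι] (r s : ι → ℝ) :
    ∏ j, ENNReal.ofReal (Real.exp (s j)) ^ r j = ENNReal.ofReal (Real.exp (∑ j, r j * s j)) := by
  rw [Real.exp_sum, ENNReal.ofReal_prod_of_nonneg fun _ _ => (Real.exp_pos _).le]
  refine Finset.prod_congr rfl fun j _ => ?_
  rw [ENNReal.ofReal_rpow_of_pos (Real.exp_pos _), ← Real.exp_mul, mul_comm]

lemma sum_prod_rpow_le {ι κ : Type*} [Fintype κ] (F : Finset ι) (u : κ → ι → ℝ≥0∞) {q : κ → ℝ}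
    (hq : ∀ j, 0 ≤ q j) (hsum : ∑ j, q j = 1) :
    ∑ i ∈ F, ∏ j, u j i ^ q j ≤ ∏ j, (∑ i ∈ F, u j i) ^ q j := by
  let _ : MeasurableSpace F := ⊤
  have h := ENNReal.lintegral_prod_norm_pow_le (μ := (Measure.count : Measure F)) Finset.univ
    (f := fun j (i : F) => u j i) (fun j _ => measurable_from_top.aemeasurable) hsum
    fun j _ => hq j
  simp only [lintegral_count, tsum_fintype] at h
  rw [← Finset.sum_coe_sort F fun i => ∏ j, u j i ^ q j]
  refine h.trans (le_of_eq ?_)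
  exact Finset.prod_congr rfl fun j _ => by rw [← Finset.sum_coe_sort F (u j)]

/-- The function whose `densityMeasure σ`-integral is that of `|f| ^ (1/ρ)`. -/
def rescaled {n : ℕ} (ρ : ℝ) (σ f : (Fin n → ℝ) → ℝ) (x : Fin n → ℝ) : ℝ≥0∞ :=
  ENNReal.ofReal |f x| ^ (1 / ρ) * (ENNReal.ofReal (σ x))⁻¹

section

variable {n : ℕ} {ρ q : ℝ} {f w : (Fin n → ℝ) → ℝ}

lemma measurable_rescaled {σ : (Fin n → ℝ) → ℝ} (hf : Measurable f) (hσ : Measurable σ) (ρ : ℝ) :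
    Measurable (rescaled ρ σ f) :=
  (hf.abs.ennreal_ofReal.pow_const _).mul hσ.ennreal_ofReal.inv

lemma setLIntegral_rescaled {σ : (Fin n → ℝ) → ℝ} (hf : Measurable f) (hσ : Measurable σ)
    (hpos : ∀ x, 0 < σ x) {Q : Set (Fin n → ℝ)} (hQ : MeasurableSet Q) (ρ : ℝ) :
    ∫⁻ x in Q, rescaled ρ σ f x ∂densityMeasure σ = ∫⁻ x in Q, ENNReal.ofReal |f x| ^ (1 / ρ) := by
  rw [densityMeasure, setLIntegral_withDensity_eq_setLIntegral_mul _ hσ.ennreal_ofReal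
    (measurable_rescaled hf hσ ρ) hQ]
  refine lintegral_congr fun x => ?_
  rw [Pi.mul_apply, rescaled, mul_left_comm, ENNReal.mul_inv_cancel (by simpa using hpos x)
    ENNReal.ofReal_ne_top, mul_one]

lemma ofReal_dualDensity_inv (hw : IsWeight w) (τ : ℝ) (x : Fin n → ℝ) :
    (ENNReal.ofReal (dualDensity τ w x))⁻¹ = ENNReal.ofReal (w x) ^ (1 / τ) := by
  rw [dualDensity, ← ENNReal.ofReal_rpow_of_pos (hw.2 x), ← ENNReal.rpow_neg, neg_div, neg_neg]

lemma ofReal_mul_rescaled_rpow (hw : IsWeight w) (hq : 0 < q) (hqρ : q < ρ) (x : Fin n → ℝ) :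
    ENNReal.ofReal (dualDensity (ρ - q) w x) *
      rescaled ρ (dualDensity (ρ - q) w) f x ^ (ρ / q) = ‖f x * w x‖ₑ ^ (1 / q) := by
  have hρ : 0 < ρ := hq.trans hqρ
  have hτ : 0 < ρ - q := sub_pos.2 hqρ
  have hw0 : ENNReal.ofReal (w x) ≠ 0 := by simpa using hw.2 x
  rw [rescaled, ofReal_dualDensity_inv hw, dualDensity, ← ENNReal.ofReal_rpow_of_pos (hw.2 x),
    ENNReal.mul_rpow_of_nonneg _ _ (by positivity), ← ENNReal.rpow_mul, ← ENNReal.rpow_mul,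
    mul_left_comm, ← ENNReal.rpow_add _ _ hw0 ENNReal.ofReal_ne_top, enorm_mul,
    ENNReal.mul_rpow_of_nonneg _ _ (by positivity), Real.enorm_eq_ofReal_abs,
    Real.enorm_eq_ofReal (hw.2 x).le]
  congr 2 <;> field_simp
  ring

lemma rescaled_eq_enorm_rpow (hw : IsWeight w) (hρ : 0 < ρ) (x : Fin n → ℝ) :
    rescaled ρ (dualDensity ρ w) f x = ‖f x * w x‖ₑ ^ (1 / ρ) := by
  rw [rescaled, ofReal_dualDensity_inv hw, enorm_mul,
    ENNReal.mul_rpow_of_nonneg _ _ (by positivity), Real.enorm_eq_ofReal_abs,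
    Real.enorm_eq_ofReal (hw.2 x).le]

lemma wnorm_eq_lintegral (hq : 0 < q) :
    wnorm q f w = (∫⁻ x, ‖f x * w x‖ₑ ^ (1 / q)) ^ q := by
  rw [wnorm, expOf, if_neg hq.ne', eLpNorm_eq_lintegral_rpow_enorm_toReal (by simpa using hq)
    ENNReal.ofReal_ne_top, ENNReal.toReal_ofReal (by positivity), one_div_one_div]

lemma SparseBoxes.exists_majorant {ι : Type*} (B : SparseBoxes n ι) (hw : IsWeight w)
    (hf : Measurable f) (hq : 0 ≤ q) (hqρ : q < ρ)
    (hσ : ∀ i, LogIntegrableOn (dualDensity (ρ - q) w) (B.Q i)) (F : Finset ι) :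
    ∃ (u : ι → ℝ≥0∞) (b : ℝ≥0∞),
      (∀ i ∈ F, (volume (B.Q i) *
          ENNReal.ofReal (Real.exp (logMean (dualDensity (ρ - q) w) (B.Q i)))) ^ q *
        ((densityMeasure (dualDensity (ρ - q) w) (B.Q i))⁻¹ * ∫⁻ x in B.Q i,
          rescaled ρ (dualDensity (ρ - q) w) f x ∂densityMeasure (dualDensity (ρ - q) w)) ^ ρ ≤
          b * u i ^ q) ∧
      b * (∑ i ∈ F, u i) ^ q ≤
        (8 * weakConst n) ^ q * ENNReal.ofReal (ρ / (ρ - q)) ^ ρ * wnorm q f w := by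
  have hρ : 0 < ρ := hq.trans_lt hqρ
  have hν0 : ∀ i, densityMeasure (dualDensity (ρ - q) w) (B.Q i) ≠ 0 := fun i => by
    rw [(hσ i).densityMeasure_eq (B.volume_Q_ne_zero i) (B.volume_Q_ne_top i)
      (B.measurableSet_Q i)]
    exact mul_ne_zero (B.volume_Q_ne_zero i)
      (by simpa using (hσ i).mean_pos (B.volume_Q_ne_zero i) (B.volume_Q_ne_top i))
  have hνt : ∀ i, densityMeasure (dualDensity (ρ - q) w) (B.Q i) ≠ ∞ := fun i => by
    rw [(hσ i).densityMeasure_eq (B.volume_Q_ne_zero i) (B.volume_Q_ne_top i)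
      (B.measurableSet_Q i)]
    exact ENNReal.mul_ne_top (B.volume_Q_ne_top i) ENNReal.ofReal_ne_top
  have hmeas := measurable_rescaled hf (hw.measurable_dualDensity (ρ - q)) ρ
  rcases hq.eq_or_lt with rfl | hq
  · refine ⟨fun _ => 1, wnorm 0 f w, fun i _ => ?_, ?_⟩
    · simp only [sub_zero] at *
      simp only [ENNReal.rpow_zero, one_mul, mul_one]
      have hN : ∀ᵐ x ∂densityMeasure (dualDensity ρ w),
          rescaled ρ (dualDensity ρ w) f x ≤ wnorm 0 f w ^ (1 / ρ) := by
        refine (withDensity_absolutelyContinuous _ _).ae_le ?_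
        filter_upwards [enorm_ae_le_eLpNormEssSup (fun x => f x * w x) volume] with x hx
        rw [rescaled_eq_enorm_rpow hw hρ, wnorm, expOf, if_pos rfl, eLpNorm_exponent_top]
        gcongr
      calc _ ≤ ((densityMeasure (dualDensity ρ w) (B.Q i))⁻¹ *
            ∫⁻ x in B.Q i, wnorm 0 f w ^ (1 / ρ) ∂densityMeasure (dualDensity ρ w)) ^ ρ := by
            gcongr ((_ * ?_) ^ _)
            exact lintegral_mono_ae (ae_restrict_of_ae hN)
        _ = wnorm 0 f w := by
            rw [setLIntegral_const, mul_comm, mul_assoc, ENNReal.mul_inv_cancel (hν0 i) (hνt i),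
              mul_one, ← ENNReal.rpow_mul, one_div_mul_cancel hρ.ne', ENNReal.rpow_one]
    · simp [div_self hρ.ne']
  · have hτ : 0 < ρ - q := sub_pos.2 hqρ
    refine ⟨fun i => volume (B.Q i) *
          ENNReal.ofReal (Real.exp (logMean (dualDensity (ρ - q) w) (B.Q i))) *
        ((densityMeasure (dualDensity (ρ - q) w) (B.Q i))⁻¹ * ∫⁻ x in B.Q i,
          rescaled ρ (dualDensity (ρ - q) w) f x ∂densityMeasure (dualDensity (ρ - q) w)) ^ (ρ / q),
      1, fun i _ => ?_, ?_⟩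
    · beta_reduce
      rw [one_mul, ENNReal.mul_rpow_of_nonneg (_ * _) (_ ^ (ρ / q)) hq.le, ← ENNReal.rpow_mul,
        div_mul_cancel₀ _ hq.ne']
    · have h := (B.hasWeakType_logMean hσ).sum_rpow_le B.measurableSet_Q hν0 hνt hmeas
        ((one_lt_div hq).2 hqρ) F
      rw [one_mul]
      refine (ENNReal.rpow_le_rpow h hq.le).trans (le_of_eq ?_)
      have hP : ρ / q / (ρ / q - 1) = ρ / (ρ - q) := by
        field_simp
      rw [wnorm_eq_lintegral hq, densityMeasure, lintegral_withDensity_eq_lintegral_mul _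
        (hw.measurable_dualDensity _).ennreal_ofReal (hmeas.pow_const _),
        ENNReal.mul_rpow_of_nonneg _ _ hq.le, ENNReal.mul_rpow_of_nonneg _ _ hq.le,
        ← ENNReal.rpow_mul, div_mul_cancel₀ _ hq.ne', hP]
      simp only [Pi.mul_apply, ofReal_mul_rescaled_rpow hw hq hqρ]

end

lemma prod_rpow_of_sum_eq_one {κ : Type*} [Fintype κ] {q : κ → ℝ} {c : ℝ≥0∞} (h0 : c ≠ 0)
    (ht : c ≠ ∞) (hsum : ∑ j, q j = 1) : ∏ j, c ^ q j = c := by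
  have h := prod_ofReal_exp_rpow q fun _ => Real.log c.toReal
  rwa [← Finset.sum_mul, hsum, one_mul, Real.exp_log (ENNReal.toReal_pos h0 ht),
    ENNReal.ofReal_toReal ht] at h

lemma prod_avg_mul_volume_le {n m : ℕ} {ρ q : Fin m → ℝ} {f w : Fin m → (Fin n → ℝ) → ℝ} {γ : ℝ}
    {W : ℝ≥0∞} (hρ : ∀ j, 0 < ρ j) (hq : ∀ j, 0 ≤ q j) (hqρ : ∀ j, q j < ρ j)
    (hsum : ∑ j, q j = 1) (hγ0 : 0 ≤ γ) (hγ : ∀ j, ρ j ≤ γ * (ρ j - q j))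
    (hw : ∀ j, IsWeight (w j)) (hprod : ∀ x, ∏ j, w j x = 1) (hf : ∀ j, Measurable (f j))
    {Q : Set (Fin n → ℝ)} (hQ : MeasurableSet Q) (h0 : volume Q ≠ 0) (ht : volume Q ≠ ∞)
    (hσ : ∀ j, LogIntegrableOn (dualDensity (ρ j - q j) (w j)) Q)
    (hW : ∏ j, avg (ρ j - q j) (fun x => (w j x)⁻¹) Q ≤ W) :
    (∏ j, avg (ρ j) (f j) Q) * volume Q ≤ W ^ γ * ∏ j,
      ((volume Q * ENNReal.ofReal (Real.exp (logMean (dualDensity (ρ j - q j) (w j)) Q))) ^ q j *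
        ((densityMeasure (dualDensity (ρ j - q j) (w j)) Q)⁻¹ * ∫⁻ x in Q,
          rescaled (ρ j) (dualDensity (ρ j - q j) (w j)) (f j) x
            ∂densityMeasure (dualDensity (ρ j - q j) (w j))) ^ ρ j) := by
  have hτ : ∀ j, 0 < ρ j - q j := fun j => sub_pos.2 (hqρ j)
  set σ : Fin m → (Fin n → ℝ) → ℝ := fun j => dualDensity (ρ j - q j) (w j)
  set s : Fin m → ℝ := fun j => Real.log (⨍ x in Q, σ j x) with hs
  set g : Fin m → ℝ := fun j => logMean (σ j) Q with hg
  set y : Fin m → ℝ≥0∞ := fun j => (densityMeasure (σ j) Q)⁻¹ *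
    ∫⁻ x in Q, rescaled (ρ j) (σ j) (f j) x ∂densityMeasure (σ j) with hy
  have hexp : ∀ j, Real.exp (s j) = ⨍ x in Q, σ j x := fun j =>
    Real.exp_log ((hσ j).mean_pos h0 ht)
  have hν : ∀ j, densityMeasure (σ j) Q = volume Q * ENNReal.ofReal (Real.exp (s j)) := fun j => by
    rw [hexp, (hσ j).densityMeasure_eq h0 ht hQ]
  have havg : ∀ j, avg (ρ j) (f j) Q = ENNReal.ofReal (Real.exp (s j)) ^ ρ j * y j ^ ρ j := by
    intro j
    have he : ENNReal.ofReal (Real.exp (s j)) ≠ 0 := by simpa using Real.exp_pos (s j)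
    rw [avg, if_neg (hρ j).ne', ← ENNReal.mul_rpow_of_nonneg _ _ (hρ j).le, hy]
    simp only
    rw [setLIntegral_rescaled (hf j) (hσ j).meas (hσ j).pos hQ, hν,
      ENNReal.mul_inv (Or.inl h0) (Or.inl ht), ← mul_assoc, mul_left_comm,
      ENNReal.mul_inv_cancel he ENNReal.ofReal_ne_top, mul_one]
  have hinv : ∏ j, avg (ρ j - q j) (fun x => (w j x)⁻¹) Q =
      ENNReal.ofReal (Real.exp (∑ j, (ρ j - q j) * s j)) := by
    rw [← prod_ofReal_exp_rpow]
    refine Finset.prod_congr rfl fun j _ => ?_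
    have h1 := hν j
    rw [densityMeasure, withDensity_apply _ hQ] at h1
    rw [(hw j).avg_inv (hτ j), h1, ENNReal.inv_mul_cancel_left h0 ht]
  have hvol : volume Q = ∏ j, volume Q ^ q j := (prod_rpow_of_sum_eq_one h0 ht hsum).symm
  have hlog : ∑ j, (ρ j - q j) * g j = 0 := by
    simp only [hg, logMean, setAverage_eq, smul_eq_mul, mul_left_comm (ρ _ - q _),
      ← integral_const_mul]
    rw [← integral_finsetSum _ fun j _ => ((hσ j).int_log.const_mul _).const_mul _]
    simp [← Finset.mul_sum, sum_mul_log_dualDensity hw hτ hprod]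
  have hkey := sum_mul_le_of_sum_eq_zero hγ
    (fun j => sub_nonneg.1 ((hσ j).defect_nonneg h0 ht)) hlog
  calc (∏ j, avg (ρ j) (f j) Q) * volume Q
      = ENNReal.ofReal (Real.exp (∑ j, ρ j * s j)) * (∏ j, y j ^ ρ j) * ∏ j, volume Q ^ q j := by
        rw [← hvol, Finset.prod_congr rfl fun j _ => havg j, Finset.prod_mul_distrib,
          prod_ofReal_exp_rpow]
    _ ≤ (W ^ γ * ENNReal.ofReal (Real.exp (∑ j, q j * g j))) * (∏ j, y j ^ ρ j) *
          ∏ j, volume Q ^ q j := by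
        gcongr
        calc ENNReal.ofReal (Real.exp (∑ j, ρ j * s j)) ≤ ENNReal.ofReal
              (Real.exp (γ * ∑ j, (ρ j - q j) * s j + ∑ j, q j * g j)) := by gcongr
          _ = ENNReal.ofReal (Real.exp (∑ j, (ρ j - q j) * s j)) ^ γ *
              ENNReal.ofReal (Real.exp (∑ j, q j * g j)) := by
              rw [Real.exp_add, ENNReal.ofReal_mul (Real.exp_pos _).le, mul_comm γ, Real.exp_mul,
                ENNReal.ofReal_rpow_of_pos (Real.exp_pos _)]
          _ ≤ _ := by
              rw [← hinv]
              gcongr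
    _ = _ := by
        rw [← prod_ofReal_exp_rpow, Finset.prod_mul_distrib]
        simp only [ENNReal.mul_rpow_of_nonneg _ _ (hq _), Finset.prod_mul_distrib]
        ring

/-- The family of boxes underlying a sparse family of cubes. -/
def SparseFamily.toBoxes {n : ℕ} (S : SparseFamily n) : SparseBoxes n S.cubes where
  corner Q := (S.isCube Q.1 Q.2).choose
  side Q := (S.isCube Q.1 Q.2).choose_spec.choose
  E Q := S.E Q.1
  side_pos Q := (S.isCube Q.1 Q.2).choose_spec.choose_spec.1
  E_subset Q := (S.E_subset Q.1 Q.2).trans (S.isCube Q.1 Q.2).choose_spec.choose_spec.2.le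
  E_meas Q := S.E_meas Q.1 Q.2
  E_disj Q Q' h := S.E_disj Q.1 Q.2 Q'.1 Q'.2 (Subtype.coe_injective.ne h)
  density Q := (measure_mono (S.isCube Q.1 Q.2).choose_spec.choose_spec.2.ge).trans
    (S.density Q.1 Q.2)

lemma SparseFamily.toBoxes_Q {n : ℕ} (S : SparseFamily n) (Q : S.cubes) : S.toBoxes.Q Q = Q.1 :=
  (S.isCube Q.1 Q.2).choose_spec.choose_spec.2.symm

lemma weakConst_pos (n : ℕ) : 0 < weakConst n := by
  unfold weakConst
  positivity

lemma weakConst_lt_top (n : ℕ) : weakConst n < ∞ := by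
  have h : weakConst n = ((3 ^ n * (3 ^ n * (8192 * 5 ^ n + 32 * (n + 1) * 4 ^ n)) : ℕ) : ℝ≥0∞) := by
    unfold weakConst
    push_cast
    ring
  rw [h]
  exact ENNReal.natCast_lt_top _

/-- **Quantitative weighted bound for multilinear sparse forms** (estimate (2.3) of
Proposition 2.5): with `∏_j w_j = 1`, `∑_j 1/p_j = 1`, `1/p_j < 1/r_j` and finite weight
constant, every sparse form satisfies
`Λ_{r⃗,S}(f⃗) ≲ c_{p⃗,r⃗} [w⃗]^{max_j (1/r_j)/(1/r_j - 1/p_j)} ∏_j ‖f_j‖_{L^{p_j}(w_j^{p_j})}`,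
with implicit constant depending only on the dimension. -/
theorem sparse_form_weighted_bound (n : ℕ) :
    ∃ C : ℝ≥0∞, 0 < C ∧ C < ∞ ∧
      ∀ (m : ℕ) (rinv pinv : Fin (m + 1) → ℝ),
        (∀ j, 0 < rinv j) → (∀ j, 0 ≤ pinv j) → (∀ j, pinv j < rinv j) →
        (∑ j, pinv j) = 1 →
        ∀ w : Fin (m + 1) → (Fin n → ℝ) → ℝ, (∀ j, IsWeight (w j)) →
          (∀ x, ∏ j, w j x = 1) → wConstS rinv pinv w < ∞ →
        ∀ (S : SparseFamily n) (f : Fin (m + 1) → (Fin n → ℝ) → ℝ),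
          (∀ j, Measurable (f j)) →
          sparseForm rinv S f ≤
            C * (∏ j, ENNReal.ofReal (rinv j / (rinv j - pinv j)) ^ (rinv j)) *
              wConstS rinv pinv w ^
                (Finset.univ.sup' ⟨0, Finset.mem_univ 0⟩ fun j =>
                  rinv j / (rinv j - pinv j)) *
              ∏ j, wnorm (pinv j) (f j) (w j) := by
  refine ⟨8 * weakConst n, ENNReal.mul_pos (by norm_num) (weakConst_pos n).ne',
    ENNReal.mul_lt_top (by norm_num) (weakConst_lt_top n), ?_⟩
  intro m ρ q hρ hq hqρ hsum w hw hprod hW S f hf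
  set W := wConstS ρ q w with hWdef
  set γ := Finset.univ.sup' ⟨0, Finset.mem_univ 0⟩ fun j => ρ j / (ρ j - q j) with hγdef
  have hτ : ∀ j, 0 < ρ j - q j := fun j => sub_pos.2 (hqρ j)
  have hle : ∀ j, ρ j / (ρ j - q j) ≤ γ := fun j =>
    Finset.le_sup' (fun j => ρ j / (ρ j - q j)) (Finset.mem_univ j)
  have hγ0 : 0 ≤ γ := (div_nonneg (hρ 0).le (hτ 0).le).trans (hle 0)
  have hWQ : ∀ i, ∏ j, avg (ρ j - q j) (fun x => (w j x)⁻¹) (S.toBoxes.Q i) ≤ W := fun i => by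
    rw [S.toBoxes_Q]
    exact le_iSup (fun Q : {Q : Set (Fin n → ℝ) // IsCube Q} =>
      ∏ j, avg (ρ j - q j) (fun x => (w j x)⁻¹) Q.1) ⟨i.1, S.isCube i.1 i.2⟩
  have hσ : ∀ j i, LogIntegrableOn (dualDensity (ρ j - q j) (w j)) (S.toBoxes.Q i) := fun j i =>
    logIntegrableOn_dualDensity hw hτ hprod (S.toBoxes.volume_Q_ne_zero i)
      (S.toBoxes.volume_Q_ne_top i) ((hWQ i).trans_lt hW).ne j
  rw [sparseForm, ENNReal.tsum_eq_iSup_sum]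
  refine iSup_le fun F => ?_
  choose u b hub hb using fun j => S.toBoxes.exists_majorant (hw j) (hf j) (hq j) (hqρ j) (hσ j) F
  calc ∑ i ∈ F, (∏ j, avg (ρ j) (f j) i.1) * volume i.1
      ≤ ∑ i ∈ F, W ^ γ * ∏ j, (b j * u j i ^ q j) := by
        refine Finset.sum_le_sum fun i hi => ?_
        rw [← S.toBoxes_Q i]
        refine (prod_avg_mul_volume_le hρ hq hqρ hsum hγ0
          (fun j => (div_le_iff₀ (hτ j)).1 (hle j)) hw hprod hf (S.toBoxes.measurableSet_Q i)
          (S.toBoxes.volume_Q_ne_zero i) (S.toBoxes.volume_Q_ne_top i) (fun j => hσ j i)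
          (hWQ i)).trans ?_
        gcongr W ^ γ * ?_
        exact Finset.prod_le_prod' fun j _ => hub j i hi
    _ = W ^ γ * ((∏ j, b j) * ∑ i ∈ F, ∏ j, u j i ^ q j) := by
        simp only [Finset.prod_mul_distrib, Finset.mul_sum]
    _ ≤ W ^ γ * ((∏ j, b j) * ∏ j, (∑ i ∈ F, u j i) ^ q j) := by
        gcongr
        exact sum_prod_rpow_le F u hq hsum
    _ = W ^ γ * ∏ j, (b j * (∑ i ∈ F, u j i) ^ q j) := by rw [Finset.prod_mul_distrib]
    _ ≤ W ^ γ * ∏ j, ((8 * weakConst n) ^ q j * ENNReal.ofReal (ρ j / (ρ j - q j)) ^ ρ j *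
          wnorm (q j) (f j) (w j)) := by
        gcongr W ^ γ * ?_
        exact Finset.prod_le_prod' fun j _ => hb j
    _ = _ := by
        have hC : ∏ j, (8 * weakConst n) ^ q j = 8 * weakConst n :=
          prod_rpow_of_sum_eq_one (mul_ne_zero (by norm_num) (weakConst_pos n).ne')
            (ENNReal.mul_ne_top (by norm_num) (weakConst_lt_top n).ne) hsum
        rw [Finset.prod_mul_distrib, Finset.prod_mul_distrib, hC]
        ring

end Paper
end
end

section
/- Weighted estimate on sparse cubes: Let r_1,…,r_{m+1} ∈ (0,∞) and p_1,…,p_{m+1} ∈ (0,∞] with 1/p_j < 1/r_j for all j and Σ_{j=1}^{m+1} 1/p_j = 1. Let w_1,…,w_{m+1} be weights with ∏_{j=1}^{m+1} w_j = 1 and [(w_1,…,w_{m+1})]_{(p_1,…,p_{m+1}),((r_1,…,r_{m+1}),∞)} < ∞, and set v_j := w_j^{ −1/(1/r_j−1/p_j) }. Then for every cube Q and every measurable E ⊆ Q with |Q| ≤ 2|E|, one has ( ∏_{j=1}^{m+1} ⟨v_j⟩_{1,Q}^{1/r_j} ) |Q| ≲ [(w_1,…,w_{m+1})]_{(p_1,…,p_{m+1}),((r_1,…,r_{m+1}),∞)}^{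 max_{j=1,…,m+1} (1/r_j)/(1/r_j−1/p_j) } ∏_{j=1}^{m+1} v_j(E)^{1/p_j}, where v_j(E) := ∫_E v_j dx and the implicit constant depends only on the exponents. -/
open MeasureTheory ENNReal

noncomputable section

namespace Paper

/-- A bound for `∏ (x j / y j) ^ a j` with `y ≤ x` gives one for `∏ (x j / y j) ^ b j`
whenever `b j ≤ a j * N`. -/
lemma prod_rpow_le_of_prod_rpow_le {ι : Type*} [Fintype ι] {x y : ι → ℝ≥0∞} {a b : ι → ℝ}
    {N : ℝ} {K : ℝ≥0∞} (hy0 : ∀ j, y j ≠ 0) (hyt : ∀ j, y j ≠ ∞) (hyx : ∀ j, y j ≤ x j)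
    (ha : ∀ j, 0 ≤ a j) (hb : ∀ j, 0 ≤ b j) (hN : 0 ≤ N) (hab : ∀ j, b j ≤ a j * N)
    (h : ∏ j, x j ^ a j ≤ K * ∏ j, y j ^ a j) :
    ∏ j, x j ^ b j ≤ K ^ N * ∏ j, y j ^ b j := by
  have hx (j : ι) : x j = x j / y j * y j := (ENNReal.div_mul_cancel (hy0 j) (hyt j)).symm
  have ht (j : ι) : 1 ≤ x j / y j := by
    rw [ENNReal.le_div_iff_mul_le (Or.inl (hy0 j)) (Or.inl (hyt j)), one_mul]
    exact hyx j
  have hsplit (d : ι → ℝ) (hd : ∀ j, 0 ≤ d j) :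
      ∏ j, x j ^ d j = (∏ j, (x j / y j) ^ d j) * ∏ j, y j ^ d j := by
    rw [← Finset.prod_mul_distrib]
    refine Finset.prod_congr rfl fun j _ => ?_
    rw [← ENNReal.mul_rpow_of_nonneg _ _ (hd j), ← hx j]
  have hK : ∏ j, (x j / y j) ^ a j ≤ K := by
    rw [hsplit a ha] at h
    refine (ENNReal.mul_le_mul_iff_left ?_ ?_).1 h
    · exact Finset.prod_ne_zero_iff.2 fun j _ =>
        (ENNReal.rpow_pos (pos_iff_ne_zero.2 (hy0 j)) (hyt j)).ne'
    · exact ENNReal.prod_ne_top fun j _ => ENNReal.rpow_ne_top_of_nonneg (ha j) (hyt j)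
  rw [hsplit b hb]
  gcongr
  calc ∏ j, (x j / y j) ^ b j ≤ ∏ j, ((x j / y j) ^ a j) ^ N := by
        refine Finset.prod_le_prod' fun j _ => ?_
        rw [← ENNReal.rpow_mul]
        exact ENNReal.rpow_le_rpow_of_exponent_le (ht j) (hab j)
    _ = (∏ j, (x j / y j) ^ a j) ^ N := ENNReal.prod_rpow_of_nonneg hN
    _ ≤ K ^ N := ENNReal.rpow_le_rpow hK hN

lemma rpow_sum_mul_prod_inv_mul_rpow {ι : Type*} [Fintype ι] {q : ℝ≥0∞} (hq0 : q ≠ 0)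
    (hqt : q ≠ ∞) (x : ι → ℝ≥0∞) {a : ι → ℝ} (ha : ∀ j, 0 ≤ a j) :
    q ^ (∑ j, a j) * ∏ j, (q⁻¹ * x j) ^ a j = ∏ j, x j ^ a j := by
  have hq (s : Finset ι) : q ^ (∑ j ∈ s, a j) = ∏ j ∈ s, q ^ a j := by
    classical
    induction s using Finset.induction_on with
    | empty => simp
    | insert i s hi ih => rw [Finset.sum_insert hi, Finset.prod_insert hi,
        ENNReal.rpow_add _ _ hq0 hqt, ih]
  rw [hq, ← Finset.prod_mul_distrib]
  refine Finset.prod_congr rfl fun j _ => ?_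
  rw [← ENNReal.mul_rpow_of_nonneg _ _ (ha j), ← mul_assoc, ENNReal.mul_inv_cancel hq0 hqt, one_mul]

/-- A form of Hölder's inequality: if `∏ V j ^ a j = 1`, then `μ E ^ ∑ a j` is at most
`∏ (∫ V j) ^ a j`, integrated over `E`. -/
lemma measure_rpow_sum_le_prod_lintegral_rpow {ι α : Type*} [Fintype ι] [MeasurableSpace α]
    {μ : Measure α} {V : ι → α → ℝ≥0∞} {a : ι → ℝ} (hV : ∀ j, Measurable (V j))
    (ha : ∀ j, 0 ≤ a j) (hA : 0 < ∑ j, a j) (h1 : ∀ x, ∏ j, V j x ^ a j = 1) (E : Set α) :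
    μ E ^ (∑ j, a j) ≤ ∏ j, (∫⁻ x in E, V j x ∂μ) ^ a j := by
  have hH := ENNReal.lintegral_prod_norm_pow_le (μ := μ.restrict E) Finset.univ
    (f := V) (fun j _ => (hV j).aemeasurable) (p := fun j => a j / ∑ j, a j)
    (by rw [← Finset.sum_div, div_self hA.ne']) (fun j _ => div_nonneg (ha j) hA.le)
  have hpt (g : ι → ℝ≥0∞) :
      ∏ j, g j ^ (a j / ∑ j, a j) = (∏ j, g j ^ a j) ^ (∑ j, a j)⁻¹ := by
    rw [← ENNReal.prod_rpow_of_nonneg (inv_nonneg.2 hA.le)]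
    simp only [← ENNReal.rpow_mul, div_eq_mul_inv]
  simp only [hpt, h1, ENNReal.one_rpow, lintegral_const, one_mul, Measure.restrict_apply_univ] at hH
  calc μ E ^ (∑ j, a j) ≤ _ := ENNReal.rpow_le_rpow hH hA.le
    _ = _ := by rw [← ENNReal.rpow_mul, inv_mul_cancel₀ hA.ne', ENNReal.rpow_one]

lemma IsCube.volume_ne_zero_and_ne_top {n : ℕ} {Q : Set (Fin n → ℝ)} (hQ : IsCube Q) :
    volume Q ≠ 0 ∧ volume Q ≠ ∞ := by
  obtain ⟨c, h, hh, rfl⟩ := hQ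
  rw [Real.volume_pi_Ico]
  simp [hh]

/-- **Weighted estimate on sparse cubes** (Lemma 2.10).  With `v_j = w_j^{-1/(1/r_j-1/p_j)}`,
for every cube `Q` and every measurable `E ⊆ Q` with `|Q| ≤ 2|E|` one has
`(∏_j ⟨v_j⟩_{1,Q}^{1/r_j})|Q| ≲ [w⃗]^{max_j (1/r_j)/(1/r_j-1/p_j)} ∏_j v_j(E)^{1/p_j}`,
with implicit constant depending only on the exponents. -/
theorem weighted_estimate_on_sparse_cubes
    (n m : ℕ) (rinv pinv : Fin (m + 1) → ℝ)
    (hr : ∀ j, 0 < rinv j) (hp0 : ∀ j, 0 ≤ pinv j) (hpr : ∀ j, pinv j < rinv j)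
    (hpsum : ∑ j, pinv j = 1) :
    ∃ C : ℝ≥0∞, 0 < C ∧ C < ∞ ∧
      ∀ w : Fin (m + 1) → (Fin n → ℝ) → ℝ, (∀ j, IsWeight (w j)) →
        (∀ x, ∏ j, w j x = 1) → wConstS rinv pinv w < ∞ →
      ∀ Q E : Set (Fin n → ℝ), IsCube Q → MeasurableSet E → E ⊆ Q →
        volume Q ≤ 2 * volume E →
        (∏ j, (avg 1 (fun x => w j x ^ (-(rinv j - pinv j)⁻¹)) Q) ^ (rinv j)) * volume Q ≤
          C * wConstS rinv pinv w ^
              (Finset.univ.sup' ⟨0, Finset.mem_univ 0⟩ fun j =>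
                rinv j / (rinv j - pinv j)) *
            ∏ j, (∫⁻ x in E, ENNReal.ofReal (w j x ^ (-(rinv j - pinv j)⁻¹))) ^ (pinv j) := by
  set a : Fin (m + 1) → ℝ := fun j => rinv j - pinv j with ha_def
  have ha (j) : 0 < a j := sub_pos.2 (hpr j)
  set M := Finset.univ.sup' ⟨0, Finset.mem_univ 0⟩ fun j => rinv j / (rinv j - pinv j)
  have hM (j) : rinv j ≤ M * a j := by
    rw [← div_le_iff₀ (ha j)]
    exact Finset.le_sup' (fun j => rinv j / (rinv j - pinv j)) (Finset.mem_univ j)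
  have hab (j) : pinv j ≤ a j * (M - 1) := by
    have := hM j
    simp only [ha_def] at this ⊢
    linarith
  have hN : 0 ≤ M - 1 := nonneg_of_mul_nonneg_right ((hp0 0).trans (hab 0)) (ha 0)
  have hA : 0 < ∑ j, a j := Finset.sum_pos (fun j _ => ha j) ⟨0, Finset.mem_univ 0⟩
  refine ⟨(2 ^ ∑ j, a j) ^ (M - 1), ?_, ?_, ?_⟩
  · exact ENNReal.rpow_pos (ENNReal.rpow_pos two_pos ofNat_ne_top)
      (ENNReal.rpow_ne_top_of_nonneg hA.le ofNat_ne_top)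
  · exact ENNReal.rpow_lt_top_of_nonneg hN (ENNReal.rpow_ne_top_of_nonneg hA.le ofNat_ne_top)
  intro w hw hw1 hW Q E hQ hE hEQ hQE
  set W := wConstS rinv pinv w
  obtain ⟨hq0, hqt⟩ := hQ.volume_ne_zero_and_ne_top
  have hE0 : volume E ≠ 0 := fun h => hq0 (by simpa [h] using hQE)
  set V : Fin (m + 1) → (Fin n → ℝ) → ℝ≥0∞ := fun j x =>
    ENNReal.ofReal (w j x ^ (-(a j)⁻¹)) with hV_def
  have hVm (j) : Measurable (V j) := ((hw j).1.pow_const _).ennreal_ofReal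
  have hVpos (j x) : 0 < V j x := ENNReal.ofReal_pos.2 (Real.rpow_pos_of_pos ((hw j).2 x) _)
  have hV1 (x) : ∏ j, V j x ^ a j = 1 := by
    have hj (j) : V j x ^ a j = ENNReal.ofReal (w j x)⁻¹ := by
      rw [hV_def, ENNReal.ofReal_rpow_of_pos (Real.rpow_pos_of_pos ((hw j).2 x) _),
        ← Real.rpow_mul ((hw j).2 x).le, neg_mul, inv_mul_cancel₀ (ha j).ne', Real.rpow_neg_one]
    simp only [hj]
    rw [← ENNReal.ofReal_prod_of_nonneg fun j _ => (inv_pos.2 ((hw j).2 x)).le,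
      Finset.prod_inv_distrib, hw1, inv_one, ENNReal.ofReal_one]
  have havg1 (j) : avg 1 (fun x => w j x ^ (-(a j)⁻¹)) Q = (volume Q)⁻¹ * ∫⁻ x in Q, V j x := by
    simp only [avg, one_ne_zero, if_false, div_one, ENNReal.rpow_one, hV_def,
      abs_of_pos (Real.rpow_pos_of_pos ((hw j).2 _) _)]
  have havg (j) : avg (a j) (fun x => (w j x)⁻¹) Q =
      ((volume Q)⁻¹ * ∫⁻ x in Q, V j x) ^ a j := by
    have hx (x) : ENNReal.ofReal |(w j x)⁻¹| ^ (1 / a j) = V j x := by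
      rw [abs_of_pos (inv_pos.2 ((hw j).2 x)), ENNReal.ofReal_rpow_of_pos (inv_pos.2 ((hw j).2 x)),
        Real.inv_rpow ((hw j).2 x).le, ← Real.rpow_neg ((hw j).2 x).le, one_div]
    simp only [avg, (ha j).ne', if_false, hx]
  have hWQ : ∏ j, ((volume Q)⁻¹ * ∫⁻ x in Q, V j x) ^ a j ≤ W := by
    simp only [← havg]
    exact le_iSup (fun Q : {Q : Set (Fin n → ℝ) // IsCube Q} =>
      ∏ j, avg (rinv j - pinv j) (fun x => (w j x)⁻¹) Q.1) ⟨Q, hQ⟩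
  have hYX (j) : ∫⁻ x in E, V j x ≤ ∫⁻ x in Q, V j x := lintegral_mono_set hEQ
  have hY0 (j) : ∫⁻ x in E, V j x ≠ 0 := by
    refine ((setLIntegral_pos_iff (hVm j)).2 ?_).ne'
    have : Function.support (V j) = Set.univ :=
      Set.eq_univ_of_forall fun x => (hVpos j x).ne'
    simpa [this, pos_iff_ne_zero] using hE0
  have hXW : ∏ j, (∫⁻ x in Q, V j x) ^ a j ≤ volume Q ^ (∑ j, a j) * W := by
    rw [← rpow_sum_mul_prod_inv_mul_rpow hq0 hqt _ fun j => (ha j).le]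
    gcongr
  have hXt (j) : ∫⁻ x in Q, V j x ≠ ∞ := by
    intro hj
    have htop : ∏ j, (∫⁻ x in Q, V j x) ^ a j = ∞ := by
      refine WithTop.prod_eq_top (Finset.mem_univ j) ?_ fun i _ h => ?_
      · exact hj ▸ ENNReal.top_rpow_of_pos (ha j)
      · exact hY0 i (le_zero_iff.1 ((ENNReal.rpow_eq_zero_iff_of_pos (ha i)).1 h ▸ hYX i))
    rw [htop, top_le_iff] at hXW
    exact ENNReal.mul_ne_top (ENNReal.rpow_ne_top_of_nonneg hA.le hqt) hW.ne hXW
  have hXY : ∏ j, (∫⁻ x in Q, V j x) ^ a j ≤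
      (2 ^ (∑ j, a j) * W) * ∏ j, (∫⁻ x in E, V j x) ^ a j := by
    calc ∏ j, (∫⁻ x in Q, V j x) ^ a j ≤ volume Q ^ (∑ j, a j) * W := hXW
      _ ≤ (2 * volume E) ^ (∑ j, a j) * W := by gcongr
      _ = (2 ^ (∑ j, a j) * W) * volume E ^ (∑ j, a j) := by
        rw [ENNReal.mul_rpow_of_nonneg _ _ hA.le]
        ring
      _ ≤ _ := by
        gcongr
        exact measure_rpow_sum_le_prod_lintegral_rpow hVm (fun j => (ha j).le) hA hV1 E
  have hπ := prod_rpow_le_of_prod_rpow_le hY0 (fun j => ((hYX j).trans_lt (hXt j).lt_top).ne) hYX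
    (fun j => (ha j).le) hp0 hN hab hXY
  have hsplit (j) : rinv j = a j + pinv j := by simp [ha_def]
  have hscale := rpow_sum_mul_prod_inv_mul_rpow hq0 hqt (fun j => ∫⁻ x in Q, V j x) hp0
  rw [hpsum, ENNReal.rpow_one] at hscale
  calc (∏ j, (avg 1 (fun x => w j x ^ (-(a j)⁻¹)) Q) ^ (rinv j)) * volume Q
      = (∏ j, ((volume Q)⁻¹ * ∫⁻ x in Q, V j x) ^ a j) *
          (volume Q * ∏ j, ((volume Q)⁻¹ * ∫⁻ x in Q, V j x) ^ pinv j) := by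
        simp only [havg1]
        simp only [hsplit, ENNReal.rpow_add_of_nonneg _ _ (ha _).le (hp0 _),
          Finset.prod_mul_distrib]
        ring
    _ ≤ W * ((2 ^ (∑ j, a j) * W) ^ (M - 1) * ∏ j, (∫⁻ x in E, V j x) ^ pinv j) := by
        rw [hscale]
        gcongr
    _ = (2 ^ ∑ j, a j) ^ (M - 1) * W ^ M * ∏ j, (∫⁻ x in E, V j x) ^ pinv j := by
        have hWM : W ^ M = W * W ^ (M - 1) := by
          conv_lhs => rw [← add_sub_cancel 1 M,
            ENNReal.rpow_add_of_nonneg _ _ zero_le_one hN, ENNReal.rpow_one]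
        rw [ENNReal.mul_rpow_of_nonneg _ _ hN, hWM]
        ring

end Paper
end
end
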